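/- arXiv:2506.00182 — 5 statements merged into one kernel-verified Lean document; each statement's English description precedes it below -/
import Mathlib

section
/- (Expected number of distinct symbols is bounded via Rényi entropy.) Let q = (q₀,q₁,…) be a probability mass function on ℕ, let n ≥ 1, and let K_n be the number of distinct values among n i.i.d. samples from q, so E[K_n] = ∑_{j=0}^∞ (1 − (1 − q_j)^n). Then for every α ∈ [0,1] (with the convention 0⁰ = 0), E[K_n] ≤ n^α · ∑_{j=0}^∞ q_j^α = n^α · exp( (1−α)·H_α(q) ). -/
open ENNReal

/-- Bernoulli's inequality in `ℝ≥0∞`, for truncated subtraction. -/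
theorem ENNReal.one_sub_one_sub_pow_le {x : ℝ≥0∞} (hx : x ≤ 1) (n : ℕ) :
    1 - (1 - x) ^ n ≤ n * x := by
  rw [tsub_le_iff_right]
  induction n with
  | zero => simp
  | succ n ih =>
    have hpow : (1 - x) ^ n ≤ (1 - x) ^ (n + 1) + x := by
      calc (1 - x) ^ n = (1 - x) ^ n * (1 - x + x) := by rw [tsub_add_cancel_of_le hx, mul_one]
        _ = (1 - x) ^ (n + 1) + (1 - x) ^ n * x := by rw [mul_add, pow_succ]
        _ ≤ (1 - x) ^ (n + 1) + x := by
          gcongr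
          exact mul_le_of_le_one_left' (pow_le_one' tsub_le_self n)
    calc (1 : ℝ≥0∞) ≤ n * x + (1 - x) ^ n := ih
      _ ≤ n * x + ((1 - x) ^ (n + 1) + x) := by gcongr
      _ = (n + 1 : ℕ) * x + (1 - x) ^ (n + 1) := by push_cast; ring

theorem ENNReal.one_sub_one_sub_pow_le_rpow {x : ℝ≥0∞} (hx : x ≤ 1) (n : ℕ) {α : ℝ}
    (hα : α ∈ Set.Icc (0 : ℝ) 1) : 1 - (1 - x) ^ n ≤ (n : ℝ≥0∞) ^ α * x ^ α := by
  rw [← ENNReal.mul_rpow_of_nonneg _ _ hα.1]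
  rcases le_total ((n : ℝ≥0∞) * x) 1 with h | h
  · calc 1 - (1 - x) ^ n ≤ n * x := ENNReal.one_sub_one_sub_pow_le hx n
      _ = (n * x) ^ (1 : ℝ) := (ENNReal.rpow_one _).symm
      _ ≤ (n * x) ^ α := ENNReal.rpow_le_rpow_of_exponent_ge h hα.2
  · calc 1 - (1 - x) ^ n ≤ 1 := tsub_le_self
      _ = (1 : ℝ≥0∞) ^ α := (ENNReal.one_rpow α).symm
      _ ≤ (n * x) ^ α := ENNReal.rpow_le_rpow h hα.1

/-- **Expected number of distinct symbols is bounded via Rényi entropy.** For a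
probability mass function `q` on `ℕ`, `n ≥ 1` and `α ∈ [0,1]`, the expected number
of distinct values among `n` i.i.d. samples, `E[K_n] = ∑_j (1 − (1 − q_j)^n)`,
satisfies `E[K_n] ≤ n^α · ∑_j q_j^α` (with the convention `0⁰ = 0`), and the latter
sum equals `exp((1−α)·H_α(q))`. Stated in `ℝ≥0∞` so that divergent sums are `∞`. -/
theorem expected_distinct_symbols_le_renyi
    (q : PMF ℕ) (n : ℕ) (hn : 1 ≤ n) (α : ℝ) (hα : α ∈ Set.Icc (0 : ℝ) 1) :
    (∑' j, (1 - (1 - q j) ^ n)) ≤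
      (n : ℝ≥0∞) ^ α * ∑' j, (if q j = 0 then 0 else q j ^ α) := by
  rw [← ENNReal.tsum_mul_left]
  refine ENNReal.tsum_le_tsum fun j => ?_
  split_ifs with hj
  · simp [hj]
  · exact ENNReal.one_sub_one_sub_pow_le_rpow (q.coe_le_one j) n hα
end

section
/- (Generalization gap bound for a finite data space.) Let Z be a finite set, H_all a set of hypotheses, ℓ : H_all × Z → ℝ a loss with DI(ℓ) = sup_{h,z} ℓ(h,z) − inf_{h,z} ℓ(h,z) < ∞, A : Z* → H_all a symmetric learning algorithm, and Q a probability mass function on Z. Then for every n ≥ 1 and all δ₁,δ₂,δ₃ > 0, if Z₁,…,Z_n are i.i.d. with law Q, with probability at least 1 − (δ₁+δ₂+δ₃): GenGap(A(Z₁,…,Z_n)) ≤ DI(ℓ)·sqrt( [ (|Z| + sqrt((n/2)·ln(2/δ₃)))·(3·ln n + ln(2π) + ln(1/δ₂)) + ln(1/δ₁) ] / (2n) ). -/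
open MeasureTheory Real

noncomputable def lossDI {H Z : Type*} (ℓ : H → Z → ℝ) : ℝ :=
  sSup (Set.range fun p : H × Z => ℓ p.1 p.2) -
    sInf (Set.range fun p : H × Z => ℓ p.1 p.2)

def SymmetricAlg {H Z : Type*} (A : List Z → H) : Prop :=
  ∀ l l' : List Z, l.Perm l' → A l = A l'

noncomputable def expRisk {H Z : Type*} (ℓ : H → Z → ℝ) (Q : PMF Z) (h : H) : ℝ :=
  ∑' z, (Q z).toReal * ℓ h z

noncomputable def empRisk {H Z : Type*} (ℓ : H → Z → ℝ) {n : ℕ} (ω : Fin n → Z) (h : H) : ℝ :=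
  (n : ℝ)⁻¹ * ∑ i, ℓ h (ω i)

noncomputable def genGap {H Z : Type*} (ℓ : H → Z → ℝ) (Q : PMF Z) {n : ℕ}
    (ω : Fin n → Z) (h : H) : ℝ :=
  expRisk ℓ Q h - empRisk ℓ ω h

open ProbabilityTheory in
/-- Hoeffding's inequality for the generalization gap of a fixed hypothesis. -/
lemma measureReal_pi_genGap_ge_le {H Z : Type*} [Fintype Z] [MeasurableSpace Z]
    [MeasurableSingletonClass Z] (ℓ : H → Z → ℝ) (Q : PMF Z) {n : ℕ} (hn : 1 ≤ n) (h : H)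
    {a b s : ℝ} (hab : a < b) (hl : ∀ z, ℓ h z ∈ Set.Icc a b) (hs : 0 ≤ s) :
    (Measure.pi fun _ : Fin n => Q.toMeasure).real
      {ω : Fin n → Z | (b - a) * s ≤ genGap ℓ Q ω h} ≤ exp (-(2 * n * s ^ 2)) := by
  have hn' : (0 : ℝ) < n := by exact_mod_cast hn
  have hD : 0 < b - a := sub_pos.2 hab
  have hmean : ∫ z, -ℓ h z ∂Q.toMeasure = -expRisk ℓ Q h := by
    simp [PMF.integral_eq_sum, expRisk, tsum_fintype]
  have hsub : HasSubgaussianMGF (fun z => -ℓ h z + expRisk ℓ Q h)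
      ((‖-a - -b‖₊ / 2) ^ 2) Q.toMeasure := by
    have := hasSubgaussianMGF_of_mem_Icc (μ := Q.toMeasure) (X := fun z => -ℓ h z)
      (a := -b) (b := -a) (measurable_of_countable _).aemeasurable
      (ae_of_all _ fun z => ⟨neg_le_neg (hl z).2, neg_le_neg (hl z).1⟩)
    simpa [hmean] using this
  have hindep : iIndepFun (fun (i : Fin n) (ω : Fin n → Z) => -ℓ h (ω i) + expRisk ℓ Q h)
      (Measure.pi fun _ => Q.toMeasure) :=
    iIndepFun_pi (X := fun _ z => -ℓ h z + expRisk ℓ Q h)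
      fun _ => (measurable_of_countable _).aemeasurable
  have hsub' (i : Fin n) : HasSubgaussianMGF
      (fun ω : Fin n → Z => -ℓ h (ω i) + expRisk ℓ Q h) ((‖-a - -b‖₊ / 2) ^ 2)
      (Measure.pi fun _ => Q.toMeasure) := by
    refine HasSubgaussianMGF.of_map (Y := fun ω : Fin n → Z => ω i)
      (X := fun z => -ℓ h z + expRisk ℓ Q h) (measurable_pi_apply i).aemeasurable ?_
    rwa [(measurePreserving_eval (fun _ : Fin n => Q.toMeasure) i).map_eq]
  have key := HasSubgaussianMGF.measure_sum_ge_le_of_iIndepFun hindep (s := Finset.univ)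
    (fun i _ => hsub' i) (ε := n * ((b - a) * s)) (by positivity)
  have hset : {ω : Fin n → Z | (b - a) * s ≤ genGap ℓ Q ω h} =
      {ω | n * ((b - a) * s) ≤ ∑ i, (-ℓ h (ω i) + expRisk ℓ Q h)} := by
    ext ω
    have : ∑ i, (-ℓ h (ω i) + expRisk ℓ Q h) = n * genGap ℓ Q ω h := by
      simp only [genGap, empRisk, Finset.sum_add_distrib, Finset.sum_neg_distrib,
        Finset.sum_const, Finset.card_univ, Fintype.card_fin, nsmul_eq_mul]
      field_simp
      ring
    simp only [Set.mem_ofPred_eq, this, mul_le_mul_iff_right₀ hn']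
  rw [hset]
  refine key.trans_eq ?_
  have hnorm : ‖-a - -b‖ = b - a := by
    rw [Real.norm_eq_abs, abs_of_nonneg] <;> linarith
  congr 1
  simp only [Finset.sum_const, Finset.card_univ, Fintype.card_fin, nsmul_eq_mul]
  push_cast
  rw [hnorm]
  field_simp

lemma genGap_le_sub {H Z : Type*} [Fintype Z] (ℓ : H → Z → ℝ) (Q : PMF Z) {n : ℕ}
    (hn : 1 ≤ n) (ω : Fin n → Z) (h : H) {a b : ℝ} (hl : ∀ z, ℓ h z ∈ Set.Icc a b) :
    genGap ℓ Q ω h ≤ b - a := by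
  have hn' : (0 : ℝ) < n := by exact_mod_cast hn
  have hQ : ∑ z, (Q z).toReal = 1 := by
    rw [← ENNReal.toReal_sum fun z _ => Q.apply_ne_top z, ← tsum_fintype (L := .unconditional Z),
      Q.tsum_coe, ENNReal.toReal_one]
  have hexp : expRisk ℓ Q h ≤ b := by
    rw [expRisk, tsum_fintype]
    calc ∑ z, (Q z).toReal * ℓ h z ≤ ∑ z, (Q z).toReal * b := by
          gcongr with z
          exact (hl z).2
      _ = b := by rw [← Finset.sum_mul, hQ, one_mul]
  have hemp : a ≤ empRisk ℓ ω h := by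
    rw [empRisk, le_inv_mul_iff₀ hn']
    calc (n : ℝ) * a = ∑ _i : Fin n, a := by simp
      _ ≤ ∑ i, ℓ h (ω i) := Finset.sum_le_sum fun i _ => (hl (ω i)).1
  exact sub_le_sub hexp hemp

/-- A symmetric algorithm on samples of size `n` factors through the vector of counts, so that a
union bound over its outputs costs a factor `(n + 1) ^ |Z|`. -/
lemma SymmetricAlg.measureReal_le {H Z : Type*} [Fintype Z] {A : List Z → H}
    (hA : SymmetricAlg A) {n : ℕ} [MeasurableSpace (Fin n → Z)] (μ : Measure (Fin n → Z))
    [IsFiniteMeasure μ] (B : H → Set (Fin n → Z)) {c : ℝ} (hc : 0 ≤ c)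
    (hB : ∀ h, μ.real (B h) ≤ c) :
    μ.real {ω | ω ∈ B (A (List.ofFn ω))} ≤ (n + 1 : ℝ) ^ Fintype.card Z * c := by
  classical
  let T : (Fin n → Z) → Z → Fin (n + 1) := fun ω z =>
    ⟨(List.ofFn ω).count z, Nat.lt_succ_of_le (List.count_le_length.trans_eq (by simp))⟩
  have hT {ω ω' : Fin n → Z} (h : T ω = T ω') : A (List.ofFn ω) = A (List.ofFn ω') :=
    hA _ _ <| List.perm_iff_count.2 fun z => congrArg Fin.val (congrFun h z)
  have hpiece (t : Z → Fin (n + 1)) :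
      μ.real {ω | T ω = t ∧ ω ∈ B (A (List.ofFn ω))} ≤ c := by
    by_cases ht : ∃ ω, T ω = t
    · obtain ⟨ω₀, rfl⟩ := ht
      refine (measureReal_mono ?_).trans (hB (A (List.ofFn ω₀)))
      rintro ω ⟨hω, hmem⟩
      rwa [hT hω] at hmem
    · have : {ω | T ω = t ∧ ω ∈ B (A (List.ofFn ω))} = ∅ :=
        Set.eq_empty_of_forall_notMem fun ω hω => ht ⟨ω, hω.1⟩
      simpa [this] using hc
  calc μ.real {ω | ω ∈ B (A (List.ofFn ω))}
      ≤ μ.real (⋃ t, {ω | T ω = t ∧ ω ∈ B (A (List.ofFn ω))}) :=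
        measureReal_mono fun ω hω => Set.mem_iUnion.2 ⟨T ω, rfl, hω⟩
    _ ≤ ∑ t, μ.real {ω | T ω = t ∧ ω ∈ B (A (List.ofFn ω))} := measureReal_iUnion_fintype_le _
    _ ≤ ∑ _t : Z → Fin (n + 1), c := Finset.sum_le_sum fun t _ => hpiece t
    _ = (n + 1 : ℝ) ^ Fintype.card Z * c := by simp

lemma log_succ_le_three_mul_log_add {n : ℕ} (hn : 1 ≤ n) :
    log (n + 1) ≤ 3 * log n + log (2 * π) := by
  have hn' : (1 : ℝ) ≤ n := by exact_mod_cast hn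
  have h₁ : log (n + 1) ≤ log n + log 2 := by
    rw [← log_mul (by positivity) (by norm_num)]
    exact log_le_log (by positivity) (by linarith)
  have h₂ : log 2 ≤ log (2 * π) := log_le_log (by norm_num) (by linarith [pi_gt_three])
  linarith [log_nonneg hn']

/-- **Generalization gap bound for a finite data space.** For a symmetric algorithm
on a finite data space `Z`, with probability at least `1 − (δ₁+δ₂+δ₃)` over an i.i.d.
sample of size `n` from `Q`, the generalization gap of the output is at most
`DI(ℓ)·sqrt(((|Z| + sqrt((n/2)·ln(2/δ₃)))·(3 ln n + ln(2π) + ln(1/δ₂)) + ln(1/δ₁))/(2n))`. -/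
theorem generalization_gap_bound_finite
    {H Z : Type*} [Fintype Z] [MeasurableSpace Z] [MeasurableSingletonClass Z]
    (ℓ : H → Z → ℝ)
    (hBddAbove : BddAbove (Set.range fun p : H × Z => ℓ p.1 p.2))
    (hBddBelow : BddBelow (Set.range fun p : H × Z => ℓ p.1 p.2))
    (A : List Z → H) (hA : SymmetricAlg A)
    (Q : PMF Z) (n : ℕ) (hn : 1 ≤ n)
    (δ₁ δ₂ δ₃ : ℝ) (hδ₁ : 0 < δ₁) (hδ₂ : 0 < δ₂) (hδ₃ : 0 < δ₃) :
    ENNReal.ofReal (1 - (δ₁ + δ₂ + δ₃)) ≤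
      Measure.pi (fun _ : Fin n => Q.toMeasure)
        {ω : Fin n → Z |
          genGap ℓ Q ω (A (List.ofFn ω)) ≤
            lossDI ℓ * Real.sqrt
              ((((Fintype.card Z : ℝ) + Real.sqrt ((n / 2) * Real.log (2 / δ₃))) *
                    (3 * Real.log n + Real.log (2 * π) + Real.log (1 / δ₂)) +
                  Real.log (1 / δ₁)) / (2 * n))} := by
  rcases le_or_gt 1 (δ₁ + δ₂ + δ₃) with hδ | hδ
  · rw [ENNReal.ofReal_of_nonpos (by linarith)]
    exact zero_le
  set E : ℝ := ((Fintype.card Z : ℝ) + Real.sqrt ((n / 2) * Real.log (2 / δ₃))) *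
    (3 * Real.log n + Real.log (2 * π) + Real.log (1 / δ₂)) + Real.log (1 / δ₁) with hE
  set s : ℝ := Real.sqrt (E / (2 * n))
  set a : ℝ := sInf (Set.range fun p : H × Z => ℓ p.1 p.2)
  set b : ℝ := sSup (Set.range fun p : H × Z => ℓ p.1 p.2)
  set μ := Measure.pi fun _ : Fin n => Q.toMeasure
  have hDI : lossDI ℓ = b - a := rfl
  have hn' : (0 : ℝ) < n := by exact_mod_cast hn
  have hl (h : H) (z : Z) : ℓ h z ∈ Set.Icc a b :=
    ⟨csInf_le hBddBelow ⟨(h, z), rfl⟩, le_csSup hBddAbove ⟨(h, z), rfl⟩⟩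
  have hab : a ≤ b := by
    obtain ⟨z, -⟩ := Q.support_nonempty
    exact (hl (A []) z).1.trans (hl (A []) z).2
  have hlog₂ : 0 ≤ log (1 / δ₂) := log_nonneg <| (one_le_div hδ₂).2 (by linarith)
  have hlog₁ : 0 ≤ log (1 / δ₁) := log_nonneg <| (one_le_div hδ₁).2 (by linarith)
  have hlog := log_succ_le_three_mul_log_add hn
  have hlog_nonneg : 0 ≤ log ((n : ℝ) + 1) := log_nonneg (by linarith)
  have hcard : Fintype.card Z * log ((n : ℝ) + 1) + log (1 / δ₁) ≤ E := by
    rw [hE]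
    gcongr
    · linarith [Real.sqrt_nonneg ((n / 2) * Real.log (2 / δ₃))]
    · linarith
  have hE_nonneg : 0 ≤ E := le_trans (by positivity) hcard
  have hexp : (n + 1 : ℝ) ^ Fintype.card Z * exp (-E) ≤ δ₁ := by
    calc (n + 1 : ℝ) ^ Fintype.card Z * exp (-E)
        ≤ (n + 1 : ℝ) ^ Fintype.card Z *
          exp (-(Fintype.card Z * log ((n : ℝ) + 1) + log (1 / δ₁))) := by gcongr
      _ = δ₁ := by
        rw [neg_add, exp_add, exp_neg (_ * _), ← log_pow, exp_log (by positivity), one_div,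
          log_inv, neg_neg, exp_log hδ₁, mul_inv_cancel_left₀ (by positivity)]
  set S : Set (Fin n → Z) := {ω | genGap ℓ Q ω (A (List.ofFn ω)) ≤ lossDI ℓ * s} with hS
  have hbad : μ.real Sᶜ ≤ δ₁ := by
    rcases hab.eq_or_lt with hab | hab
    · have : Sᶜ = ∅ := by
        refine Set.compl_empty_iff.2 (Set.eq_univ_of_forall fun ω => ?_)
        have := genGap_le_sub ℓ Q hn ω (A (List.ofFn ω)) (hl _)
        simpa [hS, hDI, hab] using this
      simpa [this] using hδ₁.le
    · have hB (h : H) : μ.real {ω | (b - a) * s ≤ genGap ℓ Q ω h} ≤ exp (-E) := by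
        refine (measureReal_pi_genGap_ge_le ℓ Q hn h hab (hl h) (Real.sqrt_nonneg _)).trans_eq ?_
        rw [Real.sq_sqrt (by positivity), mul_div_cancel₀ _ (by positivity)]
      refine (measureReal_mono fun ω hω => ?_).trans
        ((hA.measureReal_le μ _ (exp_pos _).le hB).trans hexp)
      exact (not_le.1 (show ¬ genGap ℓ Q ω (A (List.ofFn ω)) ≤ (b - a) * s from hω)).le
  have hgood : 1 ≤ μ.real S + μ.real Sᶜ := by
    simpa using measureReal_union_le (μ := μ) S Sᶜ
  exact ENNReal.ofReal_le_of_le_toReal (show _ ≤ μ.real S by linarith)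
end

section
/- (Generalization gap bound for power-law decaying distributions.) Let Z be a countably infinite set, H_all a set of hypotheses, ℓ : H_all × Z → ℝ a loss with DI(ℓ) = sup_{h,z} ℓ(h,z) − inf_{h,z} ℓ(h,z) < ∞, and A : Z* → H_all a symmetric learning algorithm. Let Q be a probability mass function on Z and suppose there are a bijection z : ℕ → Z, constants C > 0 and γ > 1 with Q(z(j)) ≤ C·(j+1)^{−γ} for all j ∈ ℕ. Set C̃ = max{C,1}. Then for every n ≥ 1 and all δ₁,δ₂,δ₃ > 0, if Z₁,…,Z_n are i.i.d. with law Q, with probability at least 1 − (δ₁+δ₂+δ₃): GenGap(A(Z₁,…,Z_n)) ≤ DI(ℓ)·sqrt( [ ( (e·C̃/(γ−1))·n^{1/γ}·(ln n + γ) + sqrt((n/2)·ln(2/δ₃)) )·(3·ln n + ln(2π) + ln(1/δ₂)) + ln(1/δ₁) ] / (2n) ). -/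
open MeasureTheory Real

theorem rpow_neg_one_add_le {x θ : ℝ} (hx : 0 < x) (hθ : 0 < θ) :
    (x + 1) ^ (-(1 + θ)) ≤ (x ^ (-θ) - (x + 1) ^ (-θ)) / θ := by
  have hx1 : 0 < x + 1 := by linarith
  have hlog : 1 / (x + 1) ≤ log ((x + 1) / x) := by
    have h := Real.one_sub_inv_le_log_of_pos (div_pos hx1 hx)
    have h' : 1 - ((x + 1) / x)⁻¹ = 1 / (x + 1) := by field_simp; ring
    rwa [h'] at h
  have hsplit : x ^ (-θ) = (x + 1) ^ (-θ) * exp (θ * log ((x + 1) / x)) := by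
    rw [Real.rpow_def_of_pos hx, Real.rpow_def_of_pos hx1, ← Real.exp_add,
      Real.log_div hx1.ne' hx.ne']
    ring_nf
  have hexp : 1 + θ * (1 / (x + 1)) ≤ exp (θ * log ((x + 1) / x)) := by
    have h := Real.add_one_le_exp (θ * log ((x + 1) / x))
    have h' := mul_le_mul_of_nonneg_left hlog hθ.le
    linarith
  have hpow : (x + 1) ^ (-(1 + θ)) = (x + 1) ^ (-θ) * (1 / (x + 1)) := by
    rw [neg_add, Real.rpow_add hx1, Real.rpow_neg_one]
    ring
  have hpos : 0 < (x + 1) ^ (-θ) := Real.rpow_pos_of_pos hx1 _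
  rw [le_div_iff₀ hθ, hpow, hsplit]
  have h := mul_le_mul_of_nonneg_left hexp hpos.le
  linarith

theorem sum_range_tail_rpow_le {N : ℕ} (hN : 1 ≤ N) {θ : ℝ} (hθ : 0 < θ) (m : ℕ) :
    ∑ j ∈ Finset.range m, (if N ≤ j then ((j : ℝ) + 1) ^ (-(1 + θ)) else 0) ≤
      (N : ℝ) ^ (-θ) / θ := by
  suffices h : ∑ j ∈ Finset.range m, (if N ≤ j then ((j : ℝ) + 1) ^ (-(1 + θ)) else 0) ≤
      ((N : ℝ) ^ (-θ) - ((max m N : ℕ) : ℝ) ^ (-θ)) / θ by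
    refine h.trans (div_le_div_of_nonneg_right ?_ hθ.le)
    have : 0 ≤ ((max m N : ℕ) : ℝ) ^ (-θ) := Real.rpow_nonneg (Nat.cast_nonneg _) _
    linarith
  induction m with
  | zero => simp
  | succ m ih =>
    rw [Finset.sum_range_succ]
    by_cases h : N ≤ m
    · have hm : (0 : ℝ) < m := by exact_mod_cast (show 0 < m by omega)
      have h1 := rpow_neg_one_add_le hm hθ
      rw [max_eq_left h] at ih
      rw [if_pos h, max_eq_left (by omega)]
      push_cast
      calc _ ≤ ((N : ℝ) ^ (-θ) - (m : ℝ) ^ (-θ)) / θ +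
            ((m : ℝ) ^ (-θ) - ((m : ℝ) + 1) ^ (-θ)) / θ := add_le_add ih h1
        _ = _ := by ring
    · rw [if_neg h, max_eq_right (by omega)]
      rw [max_eq_right (by omega)] at ih
      simpa using ih

theorem tsum_tail_rpow_le {N : ℕ} (hN : 1 ≤ N) {θ : ℝ} (hθ : 0 < θ) :
    ∑' j : ℕ, ENNReal.ofReal (if N ≤ j then ((j : ℝ) + 1) ^ (-(1 + θ)) else 0) ≤
      ENNReal.ofReal ((N : ℝ) ^ (-θ) / θ) := by
  refine ENNReal.tsum_le_of_sum_range_le fun m => ?_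
  rw [← ENNReal.ofReal_sum_of_nonneg]
  · exact ENNReal.ofReal_le_ofReal (sum_range_tail_rpow_le hN hθ m)
  · intro j _
    split_ifs <;> positivity

theorem sum_inv_succ_sq_le_two (s : Finset ℕ) :
    ∑ j ∈ s, (((j : ℝ) + 1) ^ 2)⁻¹ ≤ 2 := by
  obtain ⟨m, hm⟩ := s.exists_nat_subset_range
  have hs : s ⊆ Finset.range (m + 1) := hm.trans (Finset.range_mono (by omega))
  refine (Finset.sum_le_sum_of_subset_of_nonneg hs fun _ _ _ => by positivity).trans ?_
  have h := sum_range_tail_rpow_le le_rfl zero_lt_one (m + 1)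
  rw [Finset.sum_range_succ'] at h ⊢
  have hterm : ∀ j : ℕ, (((j + 1 : ℕ) : ℝ) + 1) ^ (-(1 + 1) : ℝ) =
      ((((j + 1 : ℕ) : ℝ) + 1) ^ 2)⁻¹ :=
    fun j => by
      rw [Real.rpow_neg (by positivity), one_add_one_eq_two, Real.rpow_two]
  simp only [Nat.le_add_left, if_true, hterm] at h
  norm_num at h ⊢
  linarith

theorem sum_multiset_prod_toFinset_le {α : Type*} [DecidableEq α] (u : α → ℝ) (hu : ∀ a, 0 ≤ u a)
    {n : ℕ} (hn : 1 ≤ n) {B : ℝ} (hB : ∀ U : Finset α, ∑ a ∈ U, u a ≤ B)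
    (F : Finset (Multiset α)) (hF : ∀ m ∈ F, ∀ a, m.count a ≤ n) :
    ∑ m ∈ F, ∏ a ∈ m.toFinset, (u a / n) ≤ exp B := by
  have hn0 : (0 : ℝ) < n := by exact_mod_cast hn
  set U : Finset α := F.biUnion Multiset.toFinset with hU
  have hsub : ∀ m ∈ F, m.toFinset ⊆ U := fun m hm => Finset.subset_biUnion_of_mem _ hm
  let g : α → ℕ → ℝ := fun a c => if c = 0 then 1 else u a / n
  have hg : ∀ a c, 0 ≤ g a c := fun a c => by
    dsimp only [g]
    split_ifs
    · exact zero_le_one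
    · exact div_nonneg (hu a) hn0.le
  let φ : Multiset α → (∀ a ∈ U, ℕ) := fun m a _ => m.count a
  have hprod : ∀ m ∈ F, ∏ a ∈ m.toFinset, (u a / n) = ∏ x ∈ U.attach, g x.1 (φ m x.1 x.2) := by
    intro m hm
    rw [Finset.prod_attach U fun a => g a (m.count a)]
    refine Finset.prod_subset_one_on_sdiff (hsub m hm) ?_ ?_
    · intro a ha
      have : a ∉ m := by simpa using (Finset.mem_sdiff.1 ha).2
      simp [g, Multiset.count_eq_zero_of_notMem this]
    · intro a ha
      have : m.count a ≠ 0 := by simpa using ha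
      simp [g, this]
  have hinj : Set.InjOn φ F := by
    intro m hm m' hm' h
    ext a
    by_cases ha : a ∈ U
    · exact congrFun (congrFun h a) ha
    · have h0 : ∀ k ∈ F, k.count a = 0 := fun k hk =>
        Multiset.count_eq_zero_of_notMem fun hak => ha (hsub k hk (by simpa using hak))
      rw [h0 m hm, h0 m' hm']
  calc ∑ m ∈ F, ∏ a ∈ m.toFinset, (u a / n)
      = ∑ m ∈ F, ∏ x ∈ U.attach, g x.1 (φ m x.1 x.2) := Finset.sum_congr rfl hprod
    _ = ∑ p ∈ F.image φ, ∏ x ∈ U.attach, g x.1 (p x.1 x.2) := 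
        (Finset.sum_image (f := fun p : (∀ a ∈ U, ℕ) => ∏ x ∈ U.attach, g x.1 (p x.1 x.2))
          hinj).symm
    _ ≤ ∑ p ∈ U.pi fun _ => Finset.range (n + 1), ∏ x ∈ U.attach, g x.1 (p x.1 x.2) := by
        refine Finset.sum_le_sum_of_subset_of_nonneg ?_ fun _ _ _ =>
          Finset.prod_nonneg fun _ _ => hg _ _
        intro p hp
        obtain ⟨m, hm, rfl⟩ := Finset.mem_image.1 hp
        refine Finset.mem_pi.2 fun a _ => ?_
        simpa [φ, Nat.lt_succ_iff] using hF m hm a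
    _ = ∏ a ∈ U, ∑ c ∈ Finset.range (n + 1), g a c := (Finset.prod_sum _ _ _).symm
    _ = ∏ a ∈ U, (u a + 1) := by
        refine Finset.prod_congr rfl fun a _ => ?_
        rw [Finset.sum_range_succ']
        simp [g]
        field_simp
    _ ≤ ∏ a ∈ U, exp (u a) := Finset.prod_le_prod
        (fun a _ => by linarith [hu a]) fun a _ => Real.add_one_le_exp _
    _ = exp (∑ a ∈ U, u a) := (Real.exp_sum _ _).symm
    _ ≤ exp B := Real.exp_le_exp.2 (hB U)

theorem measure_pi_sum_sub_integral_ge_le {Z : Type*} [MeasurableSpace Z] {μ : Measure Z}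
    [IsProbabilityMeasure μ] {g : Z → ℝ} (hg : Measurable g) {a b : ℝ}
    (hab : ∀ z, g z ∈ Set.Icc a b) (n : ℕ) {ε : ℝ} (hε : 0 ≤ ε) :
    Measure.pi (fun _ : Fin n => μ) {ω | ε ≤ ∑ i, (g (ω i) - ∫ z, g z ∂μ)} ≤
      ENNReal.ofReal (exp (-(2 * ε ^ 2 / (n * (b - a) ^ 2)))) := by
  have hind : ProbabilityTheory.iIndepFun
      (fun (i : Fin n) (ω : Fin n → Z) => g (ω i) - ∫ z, g z ∂μ) (Measure.pi fun _ => μ) :=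
    ProbabilityTheory.iIndepFun_pi (X := fun _ z => g z - ∫ z, g z ∂μ)
      fun _ => (hg.sub_const _).aemeasurable
  have hsub : ∀ i ∈ (Finset.univ : Finset (Fin n)), ProbabilityTheory.HasSubgaussianMGF
      (fun ω : Fin n → Z => g (ω i) - ∫ z, g z ∂μ) ((‖b - a‖₊ / 2) ^ 2)
      (Measure.pi fun _ => μ) := by
    intro i _
    have h := ProbabilityTheory.hasSubgaussianMGF_of_mem_Icc
      (μ := Measure.pi fun _ : Fin n => μ) (X := fun ω => g (ω i)) (a := a) (b := b)
      (hg.comp (measurable_pi_apply i)).aemeasurable (ae_of_all _ fun ω => hab _)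
    rwa [integral_comp_eval (μ := fun _ : Fin n => μ) hg.aestronglyMeasurable] at h
  have h := ProbabilityTheory.HasSubgaussianMGF.measure_sum_ge_le_of_iIndepFun hind hsub hε
  rw [← ENNReal.ofReal_toReal (measure_ne_top (Measure.pi fun _ : Fin n => μ) _)]
  refine ENNReal.ofReal_le_ofReal (h.trans (Real.exp_le_exp.2 (le_of_eq ?_)))
  simp only [Finset.sum_const, Finset.card_univ, Fintype.card_fin, nsmul_eq_mul]
  push_cast
  rw [Real.norm_eq_abs, div_pow, sq_abs, neg_div]
  congr 1
  rw [show (2 : ℝ) * (n * ((b - a) ^ 2 / 2 ^ 2)) = n * (b - a) ^ 2 / 2 by ring, div_div_eq_mul_div]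
  ring

theorem measure_pi_sum_ge_le_of_lintegral_exp_le {Z : Type*} [MeasurableSpace Z] {μ : Measure Z}
    [IsProbabilityMeasure μ] {g : Z → ℝ} (hg : Measurable g) {x : ℝ}
    (hx : ∫⁻ z, ENNReal.ofReal (exp (g z)) ∂μ ≤ ENNReal.ofReal (exp x)) (n : ℕ)
    {δ : ℝ} (hδ : 0 < δ) :
    Measure.pi (fun _ : Fin n => μ) {ω | n * x + log (1 / δ) ≤ ∑ i, g (ω i)} ≤
      ENNReal.ofReal δ := by
  have hG : Measurable fun z => ENNReal.ofReal (exp (g z)) := by fun_prop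
  have hind : ProbabilityTheory.iIndepFun
      (fun (i : Fin n) (ω : Fin n → Z) => ENNReal.ofReal (exp (g (ω i))))
      (Measure.pi fun _ => μ) :=
    ProbabilityTheory.iIndepFun_pi (X := fun _ z => ENNReal.ofReal (exp (g z)))
      fun _ => hG.aemeasurable
  have hprod : ∫⁻ ω, ∏ i, ENNReal.ofReal (exp (g (ω i))) ∂(Measure.pi fun _ : Fin n => μ) ≤
      ENNReal.ofReal (exp (n * x)) := by
    rw [ProbabilityTheory.lintegral_prod_eq_prod_lintegral_of_indepFun Finset.univ
      (fun (i : Fin n) (ω : Fin n → Z) => ENNReal.ofReal (exp (g (ω i)))) hind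
      fun i => hG.comp (measurable_pi_apply i)]
    calc _ = ∏ _i : Fin n, ∫⁻ z, ENNReal.ofReal (exp (g z)) ∂μ :=
          Finset.prod_congr rfl fun i _ =>
            (measurePreserving_eval (fun _ : Fin n => μ) i).lintegral_comp hG
      _ ≤ ∏ _i : Fin n, ENNReal.ofReal (exp x) := Finset.prod_le_prod' fun _ _ => hx
      _ = _ := by
        rw [Finset.prod_const, Finset.card_univ, Fintype.card_fin,
          ← ENNReal.ofReal_pow (exp_pos _).le, ← Real.exp_nat_mul]
  have hset : {ω : Fin n → Z | n * x + log (1 / δ) ≤ ∑ i, g (ω i)} ⊆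
      {ω | ENNReal.ofReal (exp (n * x + log (1 / δ))) ≤
        ∏ i, ENNReal.ofReal (exp (g (ω i)))} := by
    intro ω hω
    rw [Set.mem_ofPred_eq, ← ENNReal.ofReal_prod_of_nonneg fun _ _ => (exp_pos _).le,
      ← Real.exp_sum]
    exact ENNReal.ofReal_le_ofReal (Real.exp_le_exp.2 hω)
  have hmeas : Measurable fun ω : Fin n → Z => ∏ i, ENNReal.ofReal (exp (g (ω i))) :=
    Finset.measurable_fun_prod _ fun i _ => hG.comp (measurable_pi_apply i)
  refine (measure_mono hset).trans ((meas_ge_le_lintegral_div hmeas.aemeasurable ?_ ?_).trans ?_)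
  · simpa using exp_pos _
  · exact ENNReal.ofReal_ne_top
  · refine (ENNReal.div_le_div_right hprod _).trans ?_
    rw [← ENNReal.ofReal_div_of_pos (exp_pos _), ← Real.exp_sub]
    refine ENNReal.ofReal_le_ofReal (le_of_eq ?_)
    rw [sub_add_cancel_left, one_div, Real.log_inv, neg_neg, Real.exp_log hδ]

theorem loss_mem_Icc {H Z : Type*} {ℓ : H → Z → ℝ}
    (hA : BddAbove (Set.range fun p : H × Z => ℓ p.1 p.2))
    (hB : BddBelow (Set.range fun p : H × Z => ℓ p.1 p.2)) (h : H) (z : Z) :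
    ℓ h z ∈ Set.Icc (sInf (Set.range fun p : H × Z => ℓ p.1 p.2))
      (sSup (Set.range fun p : H × Z => ℓ p.1 p.2)) :=
  ⟨csInf_le hB ⟨(h, z), rfl⟩, le_csSup hA ⟨(h, z), rfl⟩⟩

section Discrete

variable {H Z : Type*} [Countable Z] [MeasurableSpace Z] [MeasurableSingletonClass Z]

theorem expRisk_eq_integral {ℓ : H → Z → ℝ}
    (hA : BddAbove (Set.range fun p : H × Z => ℓ p.1 p.2))
    (hB : BddBelow (Set.range fun p : H × Z => ℓ p.1 p.2)) (Q : PMF Z) (h : H) :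
    expRisk ℓ Q h = ∫ z, ℓ h z ∂Q.toMeasure := by
  rw [PMF.integral_eq_tsum Q (ℓ h) (Integrable.of_mem_Icc _ _
    Measurable.of_discrete.aemeasurable (ae_of_all _ (loss_mem_Icc hA hB h)))]
  rfl

theorem sum_sub_integral_eq_genGap {ℓ : H → Z → ℝ}
    (hA : BddAbove (Set.range fun p : H × Z => ℓ p.1 p.2))
    (hB : BddBelow (Set.range fun p : H × Z => ℓ p.1 p.2)) (Q : PMF Z) {n : ℕ} (hn : 1 ≤ n)
    (h : H) (ω : Fin n → Z) :
    ∑ i, (-ℓ h (ω i) - ∫ z, -ℓ h z ∂Q.toMeasure) = n * genGap ℓ Q ω h := by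
  have hn0 : (n : ℝ) ≠ 0 := by positivity
  rw [genGap, empRisk, expRisk_eq_integral hA hB, integral_neg, Finset.sum_sub_distrib,
    Finset.sum_neg_distrib, Finset.sum_const, Finset.card_univ, Fintype.card_fin, nsmul_eq_mul]
  field_simp
  ring

theorem genGap_le_lossDI {ℓ : H → Z → ℝ}
    (hA : BddAbove (Set.range fun p : H × Z => ℓ p.1 p.2))
    (hB : BddBelow (Set.range fun p : H × Z => ℓ p.1 p.2)) (Q : PMF Z) {n : ℕ} (hn : 1 ≤ n)
    (h : H) (ω : Fin n → Z) : genGap ℓ Q ω h ≤ lossDI ℓ := by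
  have hn0 : (0 : ℝ) < n := by exact_mod_cast hn
  have hI := loss_mem_Icc hA hB h
  have h1 : expRisk ℓ Q h ≤ sSup (Set.range fun p : H × Z => ℓ p.1 p.2) := by
    rw [expRisk_eq_integral hA hB]
    calc _ ≤ ∫ _z, sSup (Set.range fun p : H × Z => ℓ p.1 p.2) ∂Q.toMeasure :=
          integral_mono (Integrable.of_mem_Icc _ _ Measurable.of_discrete.aemeasurable
            (ae_of_all _ hI)) (integrable_const _) fun z => (hI z).2
      _ = _ := by simp
  have h2 : sInf (Set.range fun p : H × Z => ℓ p.1 p.2) ≤ empRisk ℓ ω h := by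
    rw [empRisk, inv_mul_eq_div, le_div_iff₀ hn0]
    calc _ = ∑ _i : Fin n, sInf (Set.range fun p : H × Z => ℓ p.1 p.2) := by simp [mul_comm]
      _ ≤ _ := Finset.sum_le_sum fun i _ => (hI (ω i)).1
  rw [genGap, lossDI]
  linarith

theorem measure_pi_genGap_gt_le {ℓ : H → Z → ℝ}
    (hA : BddAbove (Set.range fun p : H × Z => ℓ p.1 p.2))
    (hB : BddBelow (Set.range fun p : H × Z => ℓ p.1 p.2)) (hD : 0 < lossDI ℓ) (Q : PMF Z)
    {n : ℕ} (hn : 1 ≤ n) (h : H) {t : ℝ} (ht : 0 ≤ t) :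
    Measure.pi (fun _ : Fin n => Q.toMeasure)
      {ω | lossDI ℓ * √(t / (2 * n)) < genGap ℓ Q ω h} ≤ ENNReal.ofReal (exp (-t)) := by
  have hn0 : (0 : ℝ) < n := by exact_mod_cast hn
  have hI := loss_mem_Icc hA hB h
  have hε : 0 ≤ n * (lossDI ℓ * √(t / (2 * n))) := by positivity
  have hoeff := measure_pi_sum_sub_integral_ge_le (μ := Q.toMeasure) (g := fun z => -ℓ h z)
    Measurable.of_discrete (fun z => ⟨neg_le_neg (hI z).2, neg_le_neg (hI z).1⟩) n hε
  refine (measure_mono fun ω hω => ?_).trans (hoeff.trans (ENNReal.ofReal_le_ofReal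
    (Real.exp_le_exp.2 (le_of_eq ?_))))
  · rw [Set.mem_ofPred_eq, sum_sub_integral_eq_genGap hA hB Q hn]
    exact mul_le_mul_of_nonneg_left (le_of_lt hω) hn0.le
  · rw [neg_sub_neg, ← lossDI, mul_pow, mul_pow, Real.sq_sqrt (by positivity)]
    field_simp

theorem measure_pi_exists_genGap_gt_le {ι : Type*} [Countable ι] {ℓ : H → Z → ℝ}
    (hA : BddAbove (Set.range fun p : H × Z => ℓ p.1 p.2))
    (hB : BddBelow (Set.range fun p : H × Z => ℓ p.1 p.2)) (hD : 0 < lossDI ℓ) (Q : PMF Z)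
    {n : ℕ} (hn : 1 ≤ n) (hyp : ι → H) {w : ι → ℝ} (hw0 : ∀ m, 0 < w m)
    (hw : ∑' m, ENNReal.ofReal (w m) ≤ 1) {δ : ℝ} (hδ : 0 < δ) (hδ1 : δ ≤ 1) :
    Measure.pi (fun _ : Fin n => Q.toMeasure)
      {ω | ∃ m, lossDI ℓ * √((log (1 / w m) + log (1 / δ)) / (2 * n)) <
        genGap ℓ Q ω (hyp m)} ≤ ENNReal.ofReal δ := by
  have hw1 : ∀ m, w m ≤ 1 := fun m =>
    ENNReal.ofReal_le_one.1 ((ENNReal.le_tsum m).trans hw)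
  have hlog : ∀ {x : ℝ}, 0 < x → x ≤ 1 → 0 ≤ log (1 / x) := fun hx hx1 =>
    Real.log_nonneg ((one_le_div hx).2 hx1)
  have hunion : {ω : Fin n → Z | ∃ m, lossDI ℓ * √((log (1 / w m) + log (1 / δ)) / (2 * n)) <
      genGap ℓ Q ω (hyp m)} = ⋃ m, {ω | lossDI ℓ * √((log (1 / w m) + log (1 / δ)) / (2 * n)) <
        genGap ℓ Q ω (hyp m)} := by
    ext ω
    simp
  rw [hunion]
  calc _ ≤ ∑' m, _ := measure_iUnion_le _
    _ ≤ ∑' m, ENNReal.ofReal (w m) * ENNReal.ofReal δ := by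
        refine ENNReal.tsum_le_tsum fun m => ?_
        refine (measure_pi_genGap_gt_le hA hB hD Q hn (hyp m)
          (add_nonneg (hlog (hw0 m) (hw1 m)) (hlog hδ hδ1))).trans (le_of_eq ?_)
        rw [← ENNReal.ofReal_mul (hw0 m).le, one_div, one_div, Real.log_inv, Real.log_inv,
          neg_add, neg_neg, neg_neg, Real.exp_add, Real.exp_log (hw0 m), Real.exp_log hδ]
    _ = (∑' m, ENNReal.ofReal (w m)) * ENNReal.ofReal δ := ENNReal.tsum_mul_right
    _ ≤ 1 * ENNReal.ofReal δ := by gcongr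
    _ = _ := one_mul _

theorem lintegral_toMeasure_comp_equiv (Q : PMF Z) (r : Z ≃ ℕ) (F : ℕ → ENNReal) :
    ∫⁻ z, F (r z) ∂Q.toMeasure = ∑' j, F j * Q (r.symm j) := by
  rw [lintegral_countable', ← r.symm.tsum_eq]
  simp [PMF.toMeasure_apply_singleton]

theorem toMeasure_rank_ge_le (Q : PMF Z) (r : Z ≃ ℕ) {C γ : ℝ} (hC : 0 < C) (hγ : 1 < γ)
    (hdecay : ∀ j : ℕ, (Q (r.symm j)).toReal ≤ C * ((j : ℝ) + 1) ^ (-γ)) {N : ℕ} (hN : 1 ≤ N) :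
    Q.toMeasure.real {z | N ≤ r z} ≤ C * ((N : ℝ) ^ (-(γ - 1)) / (γ - 1)) := by
  have hγ0 : 0 < γ - 1 := sub_pos.2 hγ
  refine ENNReal.toReal_le_of_le_ofReal (by positivity) ?_
  rw [← lintegral_indicator_one (MeasurableSet.of_discrete),
    show ({z | N ≤ r z}.indicator (1 : Z → ENNReal)) =
      fun z => (fun j => if N ≤ j then (1 : ENNReal) else 0) (r z) from by
        ext z; simp [Set.indicator], lintegral_toMeasure_comp_equiv Q r,
    ENNReal.ofReal_mul hC.le]
  refine le_trans ?_ (mul_le_mul_right (tsum_tail_rpow_le hN hγ0) _)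
  rw [← ENNReal.tsum_mul_left]
  refine ENNReal.tsum_le_tsum fun j => ?_
  split_ifs
  · rw [one_mul, ← ENNReal.ofReal_mul hC.le, add_sub_cancel,
      ← ENNReal.ofReal_toReal (Q.apply_ne_top _)]
    exact ENNReal.ofReal_le_ofReal (hdecay j)
  · simp

theorem lintegral_exp_log_rank_le (Q : PMF Z) (r : Z ≃ ℕ) {C γ : ℝ} (hC : 0 < C) (hγ : 1 < γ)
    (hdecay : ∀ j : ℕ, (Q (r.symm j)).toReal ≤ C * ((j : ℝ) + 1) ^ (-γ)) {n : ℕ} (hn : 1 ≤ n) :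
    ∫⁻ z, ENNReal.ofReal (exp ((γ - 1) / 2 * log (max 1 (((r z : ℝ) + 1) / n)))) ∂Q.toMeasure ≤
      ENNReal.ofReal (exp (C * (n : ℝ) ^ (-(γ - 1)) / ((γ - 1) / 2))) := by
  set θ := (γ - 1) / 2 with hθdef
  have hθ : 0 < θ := by rw [hθdef]; linarith
  have hn0 : (0 : ℝ) < n := by exact_mod_cast hn
  rw [lintegral_toMeasure_comp_equiv Q r
    fun j => ENNReal.ofReal (exp (θ * log (max 1 (((j : ℝ) + 1) / n))))]
  have hterm : ∀ j : ℕ, ENNReal.ofReal (exp (θ * log (max 1 (((j : ℝ) + 1) / n)))) *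
      Q (r.symm j) ≤ Q (r.symm j) + ENNReal.ofReal (C * (n : ℝ) ^ (-θ)) *
        ENNReal.ofReal (if n ≤ j then ((j : ℝ) + 1) ^ (-(1 + θ)) else 0) := by
    intro j
    have hj : (0 : ℝ) < (j : ℝ) + 1 := by positivity
    split_ifs with h
    · have hle : (1 : ℝ) ≤ ((j : ℝ) + 1) / n := by
        rw [one_le_div hn0]
        exact_mod_cast (by omega : n ≤ j + 1)
      refine le_trans ?_ le_add_self
      rw [max_eq_right hle, ← ENNReal.ofReal_mul (by positivity),
        ← ENNReal.ofReal_toReal (Q.apply_ne_top (r.symm j)),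
        ← ENNReal.ofReal_mul (exp_pos _).le, mul_comm θ, ← Real.rpow_def_of_pos (by positivity)]
      refine ENNReal.ofReal_le_ofReal
        ((mul_le_mul_of_nonneg_left (hdecay j) (by positivity)).trans (le_of_eq ?_))
      rw [Real.div_rpow hj.le hn0.le, Real.rpow_neg hn0.le,
        show -(1 + θ) = θ + -γ by rw [hθdef]; ring, Real.rpow_add hj]
      ring
    · have hle : ((j : ℝ) + 1) / n ≤ 1 := by
        rw [div_le_one hn0]
        exact_mod_cast (by omega : j + 1 ≤ n)
      simp [max_eq_left hle]
  calc _ ≤ ∑' j : ℕ, (Q (r.symm j) + ENNReal.ofReal (C * (n : ℝ) ^ (-θ)) *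
        ENNReal.ofReal (if n ≤ j then ((j : ℝ) + 1) ^ (-(1 + θ)) else 0)) :=
        ENNReal.tsum_le_tsum hterm
    _ = 1 + ENNReal.ofReal (C * (n : ℝ) ^ (-θ)) *
        ∑' j : ℕ, ENNReal.ofReal (if n ≤ j then ((j : ℝ) + 1) ^ (-(1 + θ)) else 0) := by
        rw [ENNReal.tsum_add, ENNReal.tsum_mul_left, r.symm.tsum_eq fun z => Q z, Q.tsum_coe]
    _ ≤ 1 + ENNReal.ofReal (C * (n : ℝ) ^ (-θ)) * ENNReal.ofReal ((n : ℝ) ^ (-θ) / θ) := by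
        gcongr
        exact tsum_tail_rpow_le hn hθ
    _ = ENNReal.ofReal (C * (n : ℝ) ^ (-(γ - 1)) / θ + 1) := by
        rw [← ENNReal.ofReal_mul (by positivity), ← ENNReal.ofReal_one,
          ← ENNReal.ofReal_add zero_le_one (by positivity),
          show -(γ - 1) = -θ + -θ by rw [hθdef]; ring, Real.rpow_add hn0]
        ring_nf
    _ ≤ _ := ENNReal.ofReal_le_ofReal (Real.add_one_le_exp _)

end Discrete

theorem card_image_le_add_sum {ι Z : Type*} [Fintype ι] [DecidableEq Z] (r : Z ≃ ℕ) (N : ℕ)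
    (ω : ι → Z) :
    ((Finset.univ.image ω).card : ℝ) ≤ N + ∑ i, if N ≤ r (ω i) then (1 : ℝ) else 0 := by
  have hhead : ((Finset.univ.image ω).filter fun z => ¬ N ≤ r z).card ≤ N := by
    rw [← Finset.card_range N]
    refine Finset.card_le_card_of_injOn r (fun z hz => ?_) r.injective.injOn
    simpa using (Finset.mem_filter.1 hz).2
  have htail : (((Finset.univ.image ω).filter fun z => N ≤ r z).card : ℝ) ≤
      ∑ i, if N ≤ r (ω i) then (1 : ℝ) else 0 := by
    rw [← Finset.sum_boole]
    exact Finset.sum_image_le_of_nonneg fun a _ => by split_ifs <;> norm_num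
  rw [← Finset.card_filter_add_card_filter_not (s := Finset.univ.image ω) (fun z => N ≤ r z)]
  push_cast
  have hhead' : ((((Finset.univ.image ω).filter fun z => ¬ N ≤ r z).card : ℕ) : ℝ) ≤ N :=
    Nat.cast_le.2 hhead
  linarith

theorem log_two_pi_gt : 1.69 < log (2 * π) := by
  have h3 : (1 : ℝ) < log π := by
    rw [Real.lt_log_iff_exp_lt Real.pi_pos]
    linarith [Real.exp_one_lt_d9, Real.pi_gt_three]
  rw [Real.log_mul two_ne_zero Real.pi_ne_zero]
  linarith [Real.log_two_gt_d9]

theorem code_length_le_of_inv_le {L X c g s d K W p E : ℝ} (hL : 0.69 ≤ L) (hX : 1 ≤ X)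
    (hc : 1 ≤ c) (hg : 0 < g) (hs : 0 ≤ s) (hd : 0 ≤ d) (hp : 1.69 ≤ p) (hE : 2.7 ≤ E)
    (hgL : 1 / g ≤ L ^ 2 + L + 1 / 2) (hK : K ≤ X + 1 + c * X / g + s)
    (hW : g / 2 * W ≤ c * X / (g / 2) + d) :
    2 + 3 * K * L + 2 * W ≤ (E * c / g * X * (L + (g + 1)) + s) * (3 * L + p + d) := by
  obtain ⟨Y, hY⟩ : ∃ Y, Y = c * X / g := ⟨_, rfl⟩
  have hcX : 1 ≤ c * X := one_le_mul_of_one_le_of_one_le hc hX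
  have hYg : Y * g = c * X := by rw [hY]; field_simp
  have hY0 : 0 < Y := by rw [hY]; positivity
  have hinv : 0 < 1 / g := by positivity
  have hYinv : 1 / g ≤ Y := by rw [hY]; exact div_le_div_of_nonneg_right hcX hg.le
  have hW' : 2 * W ≤ 8 * (Y * (1 / g)) + 4 * (1 / g) * d := by
    have h : W ≤ (c * X / (g / 2) + d) / (g / 2) := by
      rw [le_div_iff₀ (by positivity)]; linarith
    have h' : (c * X / (g / 2) + d) / (g / 2) = 4 * (Y * (1 / g)) + 2 * (1 / g) * d := by
      rw [hY]; field_simp; ring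
    linarith
  have hYg1 : 1 ≤ Y * g := hYg ▸ hcX
  have hK' : K ≤ 2 * (Y * g) + Y + s := by
    have : X ≤ c * X := le_mul_of_one_le_left (by linarith) hc
    rw [← hY] at hK
    linarith
  have hR : E * c / g * X * (L + (g + 1)) = E * Y * (L + (g + 1)) := by rw [hY]; ring
  have hsum : 0 ≤ Y * (L + (g + 1)) := by positivity
  have hR' : 2.7 * (Y * (L + (g + 1))) ≤ E * Y * (L + (g + 1)) := by
    rw [mul_assoc]
    exact mul_le_mul_of_nonneg_right hE hsum
  rw [hR]
  have hL0 : 0 ≤ L := by linarith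
  have hp0 : 0 ≤ p := by linarith
  have hlow : (2.7 * (Y * (L + (g + 1))) + s) * (3 * L + p + d) ≤
      (E * Y * (L + (g + 1)) + s) * (3 * L + p + d) :=
    mul_le_mul_of_nonneg_right (by linarith) (by positivity)
  refine le_trans ?_ hlow
  have hKL : 3 * K * L ≤ 3 * L * (2 * (Y * g) + Y + s) := by
    have := mul_le_mul_of_nonneg_left hK' (by positivity : 0 ≤ 3 * L)
    linarith
  have hYinv2 : 8 * (Y * (1 / g)) ≤ 8 * (Y * (L ^ 2 + L + 1 / 2)) := by gcongr
  have hdterm : 4 * (1 / g) * d ≤ 2.7 * (Y * (L + (g + 1))) * d := by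
    refine mul_le_mul_of_nonneg_right ?_ hd
    have h1 : Y * 1.69 ≤ Y * (L + (g + 1)) :=
      mul_le_mul_of_nonneg_left (by linarith) hY0.le
    linarith
  have hpterm : 2.7 * (Y * (L + (g + 1))) * 1.69 ≤ 2.7 * (Y * (L + (g + 1))) * p :=
    mul_le_mul_of_nonneg_left hp (by positivity)
  have hsp : 0 ≤ s * (p + d) := by positivity
  have hYL : 0 ≤ Y * L := by positivity
  have hYLL : 0 ≤ Y * L ^ 2 := by positivity
  have hYLg : 0 ≤ Y * g * L := by positivity
  linarith

theorem rpow_inv_ge_half {x γ : ℝ} (hx : 1 ≤ x) (hγ : 1 < γ)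
    (h : log x ^ 2 + log x + 1 / 2 ≤ 1 / (γ - 1)) : x / 2 ≤ x ^ γ⁻¹ := by
  have hx0 : 0 < x := by linarith
  have hg : 0 < γ - 1 := by linarith
  have hL : 0 ≤ log x := Real.log_nonneg hx
  have hLg : log x * (γ - 1) ≤ 1 / 2 := by
    rw [le_div_iff₀ hg] at h
    nlinarith [mul_nonneg (sq_nonneg (log x - 1 / 2)) hg.le]
  have hmul : log x * (1 - γ⁻¹) ≤ 1 / 2 := by
    have : 1 - γ⁻¹ ≤ γ - 1 := by
      have hγγ : γ * γ⁻¹ = 1 := mul_inv_cancel₀ (by linarith)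
      have : 0 < γ⁻¹ := by positivity
      nlinarith [mul_nonneg (sq_nonneg (γ - 1)) this.le]
    exact (mul_le_mul_of_nonneg_left this hL).trans hLg
  have hexp := Real.add_one_le_exp (-(log x * (1 - γ⁻¹)))
  calc x / 2 = x * (1 / 2) := by ring
    _ ≤ x * exp (-(log x * (1 - γ⁻¹))) := by gcongr; linarith
    _ = x ^ γ⁻¹ := by
      nth_rewrite 1 [← Real.exp_log hx0]
      rw [Real.rpow_def_of_pos hx0, ← Real.exp_add]
      ring_nf

theorem two_mul_le_of_le_inv {x L X c g s d p E : ℝ} (hx : 0 ≤ x) (hL : 0.69 ≤ L)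
    (hX : x / 2 ≤ X) (hc : 1 ≤ c) (hg : 0 < g) (hs : 0 ≤ s) (hd : 0 ≤ d) (hp : 1.69 ≤ p)
    (hE : 2.7 ≤ E) (hgL : L ^ 2 + L + 1 / 2 ≤ 1 / g) :
    2 * x ≤ (E * c / g * X * (L + (g + 1)) + s) * (3 * L + p + d) := by
  have hginv : 1 ≤ 1 / g := by nlinarith
  have hE' : 2 * 1 * 1 ≤ E * c * (1 / g) := by gcongr; linarith
  have hR : 2 * 1 * 1 * (x / 2) * 1 ≤ E * c / g * X * (L + (g + 1)) := by
    rw [show E * c / g = E * c * (1 / g) by ring]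
    have hX0 : 0 ≤ X := by linarith
    have hEc : 0 ≤ E * c * (1 / g) * X := by positivity
    gcongr
    linarith
  calc 2 * x = (2 * 1 * 1 * (x / 2) * 1 + 0) * (2 + 0 + 0) := by ring
    _ ≤ _ := by gcongr <;> linarith

theorem two_le_of_log_eq_zero {c g s d p E : ℝ} (hc : 1 ≤ c) (hg : 0 < g) (hs : 0 ≤ s)
    (hd : 0 ≤ d) (hp : 1.69 ≤ p) (hE : 2.7 ≤ E) :
    2 ≤ (E * c / g * 1 * (0 + (g + 1)) + s) * (3 * 0 + p + d) := by
  have hR : 2 ≤ E * c / g * 1 * (0 + (g + 1)) := by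
    calc (2 : ℝ) ≤ 2.7 * 1 := by norm_num
      _ ≤ E * c := by gcongr
      _ ≤ E * c * (1 + 1 / g) := by
        have : 0 ≤ E * c * (1 / g) := by positivity
        linarith
      _ = _ := by field_simp; ring
  calc (2 : ℝ) = (2 + 0) * (0 + 1 + 0) := by norm_num
    _ ≤ _ := by gcongr <;> linarith

/-- A weight on multisets of size at most `n` depending only on the ranks of the distinct elements;
its total mass is at most one. -/
noncomputable def rankWeight {Z : Type*} [DecidableEq Z] (r : Z → ℕ) (n : ℕ) (m : Multiset Z) : ℝ :=
  exp (-2) * ∏ a ∈ m.toFinset, ((((r a : ℝ) + 1) ^ (2 : ℕ))⁻¹ / (n : ℝ))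

theorem rankWeight_pos {Z : Type*} [DecidableEq Z] (r : Z → ℕ) {n : ℕ} (hn : 1 ≤ n)
    (m : Multiset Z) : 0 < rankWeight r n m :=
  mul_pos (exp_pos _) (Finset.prod_pos fun _ _ => by positivity)

theorem tsum_rankWeight_le_one {Z : Type*} [DecidableEq Z] (r : Z ≃ ℕ) {n : ℕ} (hn : 1 ≤ n) :
    ∑' m : {m : Multiset Z // m.card = n}, ENNReal.ofReal (rankWeight r n m) ≤ 1 := by
  rw [ENNReal.tsum_eq_iSup_sum]
  refine iSup_le fun F => ?_
  rw [← ENNReal.ofReal_sum_of_nonneg fun m _ => (rankWeight_pos r hn _).le]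
  refine ENNReal.ofReal_le_one.2 ?_
  have hB : ∀ U : Finset Z, ∑ a ∈ U, (((r a : ℝ) + 1) ^ 2)⁻¹ ≤ 2 := fun U => by
    simpa using sum_inv_succ_sq_le_two (U.map r.toEmbedding)
  have h := sum_multiset_prod_toFinset_le (fun a => (((r a : ℝ) + 1) ^ 2)⁻¹)
    (fun a => by positivity) hn hB (F.map (Function.Embedding.subtype _)) (by
      intro m hm a
      obtain ⟨⟨m', hm'⟩, -, rfl⟩ := Finset.mem_map.1 hm
      exact (Multiset.count_le_card _ _).trans hm'.le)
  rw [Finset.sum_map] at h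
  calc ∑ m ∈ F, rankWeight r n m = exp (-2) * _ := (Finset.mul_sum _ _ _).symm
    _ ≤ exp (-2) * exp 2 := mul_le_mul_of_nonneg_left h (exp_pos _).le
    _ = 1 := by rw [← Real.exp_add]; simp

theorem log_one_div_rankWeight_ofFn_le {Z : Type*} [DecidableEq Z] (r : Z ≃ ℕ) {n : ℕ}
    (hn : 1 ≤ n) (ω : Fin n → Z) :
    log (1 / rankWeight r n (List.ofFn ω : Multiset Z)) ≤
      2 + 3 * ((Finset.univ.image ω).card : ℝ) * log n +
        2 * ∑ i, log (max 1 (((r (ω i) : ℝ) + 1) / n)) := by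
  have hn0 : (0 : ℝ) < n := by exact_mod_cast hn
  have hS : (List.ofFn ω : Multiset Z).toFinset = Finset.univ.image ω := by
    ext a
    simp [eq_comm]
  have hterm : ∀ a, -log ((((r a : ℝ) + 1) ^ 2)⁻¹ / n) ≤
      3 * log n + 2 * log (max 1 (((r a : ℝ) + 1) / n)) := by
    intro a
    have ha : (0 : ℝ) < (r a : ℝ) + 1 := by positivity
    have hmax : (0 : ℝ) < max 1 (((r a : ℝ) + 1) / n) := lt_max_of_lt_left one_pos
    have hle : log ((r a : ℝ) + 1) ≤ log n + log (max 1 (((r a : ℝ) + 1) / n)) := by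
      rw [← Real.log_mul hn0.ne' hmax.ne']
      refine Real.log_le_log ha ?_
      calc (r a : ℝ) + 1 = n * (((r a : ℝ) + 1) / n) := by field_simp
        _ ≤ _ := by gcongr; exact le_max_right _ _
    rw [Real.log_div (by positivity) hn0.ne', Real.log_inv, Real.log_pow]
    push_cast
    linarith
  have hnonneg : ∀ a, 0 ≤ log (max 1 (((r a : ℝ) + 1) / n)) := fun a =>
    Real.log_nonneg (le_max_left _ _)
  rw [one_div, Real.log_inv, rankWeight, hS, Real.log_mul (exp_pos _).ne'
    (Finset.prod_pos fun _ _ => by positivity).ne', Real.log_exp,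
    Real.log_prod fun _ _ => by positivity, neg_add, neg_neg, ← Finset.sum_neg_distrib]
  have h1 := Finset.sum_le_sum fun a (_ : a ∈ Finset.univ.image ω) => hterm a
  have h2 := Finset.sum_image_le_of_nonneg (s := Finset.univ) (g := ω)
    (f := fun a => log (max 1 (((r a : ℝ) + 1) / n))) fun a _ => hnonneg a
  rw [Finset.sum_add_distrib, ← Finset.mul_sum, ← Finset.mul_sum, Finset.sum_const,
    nsmul_eq_mul] at h1
  linarith

theorem mul_rpow_neg_sub_one_le_rpow_inv {x γ : ℝ} (hx : 1 ≤ x) (hγ : 0 < γ) :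
    x * x ^ (-(γ - 1)) ≤ x ^ γ⁻¹ := by
  nth_rewrite 1 [← Real.rpow_one x]
  rw [← Real.rpow_add (by linarith)]
  refine Real.rpow_le_rpow_of_exponent_le hx ?_
  have h : γ * γ⁻¹ = 1 := mul_inv_cancel₀ hγ.ne'
  have h' : 0 < γ⁻¹ := by positivity
  nlinarith [mul_nonneg (sq_nonneg (γ - 1)) h'.le]

section Discrete

variable {Z : Type*} [Countable Z] [MeasurableSpace Z] [MeasurableSingletonClass Z]

theorem measure_pi_card_image_ge_le [DecidableEq Z] (Q : PMF Z) (r : Z ≃ ℕ) {C γ : ℝ} (hC : 0 < C)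
    (hγ : 1 < γ) (hdecay : ∀ j : ℕ, (Q (r.symm j)).toReal ≤ C * ((j : ℝ) + 1) ^ (-γ)) {n : ℕ}
    (hn : 1 ≤ n) {δ : ℝ} (hδ : 0 < δ) (hδ1 : δ ≤ 1) :
    Measure.pi (fun _ : Fin n => Q.toMeasure)
      {ω | (n : ℝ) ^ γ⁻¹ + 1 + C * (n : ℝ) ^ γ⁻¹ / (γ - 1) + √(n / 2 * log (2 / δ)) ≤
        ((Finset.univ.image ω).card : ℝ)} ≤ ENNReal.ofReal δ := by
  have hn0 : (0 : ℝ) < n := by exact_mod_cast hn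
  have hg : 0 < γ - 1 := sub_pos.2 hγ
  have hX : 0 < (n : ℝ) ^ γ⁻¹ := Real.rpow_pos_of_pos hn0 _
  set N := ⌈(n : ℝ) ^ γ⁻¹⌉₊ with hN
  have hN1 : 1 ≤ N := Nat.one_le_ceil_iff.2 hX
  have hlog : 0 ≤ log (2 / δ) := Real.log_nonneg ((one_le_div hδ).2 (by linarith))
  have hint : ∫ z, (if N ≤ r z then (1 : ℝ) else 0) ∂Q.toMeasure =
      Q.toMeasure.real {z | N ≤ r z} := by
    rw [← integral_indicator_one MeasurableSet.of_discrete]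
    congr 1
    ext z
    simp [Set.indicator]
  have hmean : n * Q.toMeasure.real {z | N ≤ r z} ≤ C * (n : ℝ) ^ γ⁻¹ / (γ - 1) := by
    have hNX : (N : ℝ) ^ (-(γ - 1)) ≤ ((n : ℝ) ^ γ⁻¹) ^ (-(γ - 1)) :=
      Real.rpow_le_rpow_of_nonpos hX (Nat.le_ceil _) (by linarith)
    have hpow : n * ((n : ℝ) ^ γ⁻¹) ^ (-(γ - 1)) = (n : ℝ) ^ γ⁻¹ := by
      rw [← Real.rpow_mul hn0.le]
      nth_rewrite 1 [← Real.rpow_one (n : ℝ)]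
      rw [← Real.rpow_add hn0]
      congr 1
      field_simp
      ring
    calc _ ≤ n * (C * (((n : ℝ) ^ γ⁻¹) ^ (-(γ - 1)) / (γ - 1))) := by
          refine mul_le_mul_of_nonneg_left
            ((toMeasure_rank_ge_le Q r hC hγ hdecay hN1).trans ?_) hn0.le
          gcongr
      _ = C * (n * ((n : ℝ) ^ γ⁻¹) ^ (-(γ - 1))) / (γ - 1) := by ring
      _ = _ := by rw [hpow]
  have hoeff := measure_pi_sum_sub_integral_ge_le (μ := Q.toMeasure)
    (g := fun z => if N ≤ r z then (1 : ℝ) else 0) (a := 0) (b := 1) Measurable.of_discrete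
    (fun z => by split_ifs <;> simp) n (Real.sqrt_nonneg (n / 2 * log (2 / δ)))
  refine (measure_mono fun ω hω => ?_).trans (hoeff.trans (ENNReal.ofReal_le_ofReal ?_))
  · rw [Set.mem_ofPred_eq] at hω ⊢
    rw [hint, Finset.sum_sub_distrib, Finset.sum_const, Finset.card_univ, Fintype.card_fin,
      nsmul_eq_mul]
    have h1 := card_image_le_add_sum r N ω
    have h2 : (N : ℝ) < (n : ℝ) ^ γ⁻¹ + 1 := Nat.ceil_lt_add_one hX.le
    linarith
  · rw [Real.sq_sqrt (by positivity), show -(2 * (n / 2 * log (2 / δ)) / (n * (1 - 0) ^ 2)) =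
      log (δ / 2) by rw [← inv_div δ 2, Real.log_inv]; field_simp; ring,
      Real.exp_log (by positivity)]
    linarith

theorem measure_pi_sum_log_rank_ge_le (Q : PMF Z) (r : Z ≃ ℕ) {C γ : ℝ} (hC : 0 < C)
    (hγ : 1 < γ) (hdecay : ∀ j : ℕ, (Q (r.symm j)).toReal ≤ C * ((j : ℝ) + 1) ^ (-γ)) {n : ℕ}
    (hn : 1 ≤ n) {δ : ℝ} (hδ : 0 < δ) :
    Measure.pi (fun _ : Fin n => Q.toMeasure)
      {ω | C * (n : ℝ) ^ γ⁻¹ / ((γ - 1) / 2) + log (1 / δ) ≤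
        (γ - 1) / 2 * ∑ i, log (max 1 (((r (ω i) : ℝ) + 1) / n))} ≤ ENNReal.ofReal δ := by
  have hg : 0 < (γ - 1) / 2 := by linarith
  refine (measure_mono fun ω hω => ?_).trans (measure_pi_sum_ge_le_of_lintegral_exp_le
    Measurable.of_discrete (lintegral_exp_log_rank_le Q r hC hγ hdecay hn) n hδ)
  rw [Set.mem_ofPred_eq] at hω ⊢
  rw [← Finset.mul_sum]
  refine le_trans (add_le_add_left ?_ _) hω
  rw [← mul_div_assoc, mul_left_comm]
  have := mul_rpow_neg_sub_one_le_rpow_inv (x := n) (by exact_mod_cast hn) (by linarith : 0 < γ)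
  gcongr

end Discrete

/-- **Generalization gap bound for power-law decaying distributions.** Let `Z` be
countably infinite (witnessed by a bijection `e : ℕ → Z`) and suppose
`Q(e j) ≤ C·(j+1)^{−γ}` with `C > 0`, `γ > 1`; set `C̃ = max{C,1}`. Then for a
symmetric algorithm, with probability at least `1 − (δ₁+δ₂+δ₃)` over an i.i.d. sample
of size `n ≥ 1` from `Q`, the generalization gap is at most
`DI(ℓ)·sqrt((((eC̃/(γ−1))·n^{1/γ}·(ln n + γ) + sqrt((n/2)·ln(2/δ₃)))·(3 ln n + ln(2π) + ln(1/δ₂)) + ln(1/δ₁))/(2n))`. -/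
theorem generalization_gap_bound_power_law_decay
    {H Z : Type*} [Countable Z] [MeasurableSpace Z] [MeasurableSingletonClass Z]
    (ℓ : H → Z → ℝ)
    (hBddAbove : BddAbove (Set.range fun p : H × Z => ℓ p.1 p.2))
    (hBddBelow : BddBelow (Set.range fun p : H × Z => ℓ p.1 p.2))
    (A : List Z → H) (hA : SymmetricAlg A)
    (Q : PMF Z) (e : ℕ → Z) (he : Function.Bijective e)
    (C γ : ℝ) (hC : 0 < C) (hγ : 1 < γ)
    (hdecay : ∀ j : ℕ, (Q (e j)).toReal ≤ C * ((j : ℝ) + 1) ^ (-γ))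
    (n : ℕ) (hn : 1 ≤ n)
    (δ₁ δ₂ δ₃ : ℝ) (hδ₁ : 0 < δ₁) (hδ₂ : 0 < δ₂) (hδ₃ : 0 < δ₃) :
    ENNReal.ofReal (1 - (δ₁ + δ₂ + δ₃)) ≤
      Measure.pi (fun _ : Fin n => Q.toMeasure)
        {ω : Fin n → Z |
          genGap ℓ Q ω (A (List.ofFn ω)) ≤
            lossDI ℓ * Real.sqrt
              ((((Real.exp 1 * max C 1 / (γ - 1)) * (n : ℝ) ^ γ⁻¹ *
                      (Real.log n + γ) +
                      Real.sqrt ((n / 2) * Real.log (2 / δ₃))) *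
                    (3 * Real.log n + Real.log (2 * π) + Real.log (1 / δ₂)) +
                  Real.log (1 / δ₁)) / (2 * n))} := by
  classical
  set L := log (n : ℝ) with hLdef
  set p := log (2 * π) with hpdef
  set s := √((n : ℝ) / 2 * log (2 / δ₃)) with hsdef
  set X := (n : ℝ) ^ γ⁻¹ with hXdef
  set T := (exp 1 * max C 1 / (γ - 1) * X * (L + γ) + s) * (3 * L + p + log (1 / δ₂)) with hT
  set μ := Measure.pi fun _ : Fin n => Q.toMeasure with hμ
  by_cases hδ : 1 ≤ δ₁ + δ₂ + δ₃
  · rw [ENNReal.ofReal_of_nonpos (by linarith)]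
    exact zero_le
  have hlog : ∀ {x : ℝ}, 0 < x → x ≤ 1 → 0 ≤ log (1 / x) := fun hx hx1 =>
    Real.log_nonneg ((one_le_div hx).2 hx1)
  have hd₁ : 0 ≤ log (1 / δ₁) := hlog hδ₁ (by linarith)
  have hd₂ : 0 ≤ log (1 / δ₂) := hlog hδ₂ (by linarith)
  have hn1 : (1 : ℝ) ≤ n := by exact_mod_cast hn
  have hn0 : (0 : ℝ) < n := by linarith
  have hg : 0 < γ - 1 := sub_pos.2 hγ
  have hp : 1.69 ≤ p := log_two_pi_gt.le
  have hE : 2.7 ≤ exp 1 := by linarith [Real.exp_one_gt_d9]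
  have hs : 0 ≤ s := Real.sqrt_nonneg _
  have hc : 1 ≤ max C 1 := le_max_right _ _
  have hX : 1 ≤ X := Real.one_le_rpow hn1 (by positivity)
  have hγg : γ = γ - 1 + 1 := by ring
  have hD : 0 ≤ lossDI ℓ :=
    sub_nonneg.2 (Set.nonempty_Icc.1 ⟨_, loss_mem_Icc hBddAbove hBddBelow (A []) (e 0)⟩)
  have htriv : 2 * n ≤ T ∨ lossDI ℓ = 0 → ENNReal.ofReal (1 - (δ₁ + δ₂ + δ₃)) ≤
      μ {ω | genGap ℓ Q ω (A (List.ofFn ω)) ≤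
        lossDI ℓ * √((T + log (1 / δ₁)) / (2 * n))} := by
    intro h
    have huniv : {ω : Fin n → Z | genGap ℓ Q ω (A (List.ofFn ω)) ≤
        lossDI ℓ * √((T + log (1 / δ₁)) / (2 * n))} = Set.univ := by
      refine Set.eq_univ_of_forall fun ω => ?_
      refine (genGap_le_lossDI hBddAbove hBddBelow Q hn _ ω).trans ?_
      rcases h with h | h
      · refine le_mul_of_one_le_right hD (Real.one_le_sqrt.2 ?_)
        rw [one_le_div (by positivity)]
        linarith
      · rw [h, zero_mul]
    rw [huniv, measure_univ]
    exact ENNReal.ofReal_le_one.2 (by linarith)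
  rcases hD.eq_or_lt with hD0 | hDpos
  · exact htriv (Or.inr hD0.symm)
  rcases hn.eq_or_lt with rfl | hn2
  · refine htriv (Or.inl ?_)
    have h := two_le_of_log_eq_zero hc hg hs hd₂ hp hE
    rw [hT, hXdef, hLdef]
    rw [← hγg] at h
    simpa using h
  have hL : 0.69 ≤ L := by
    have : log 2 ≤ L := Real.log_le_log two_pos (by exact_mod_cast hn2)
    linarith [Real.log_two_gt_d9]
  rcases le_total (L ^ 2 + L + 1 / 2) (1 / (γ - 1)) with hgL | hgL
  · refine htriv (Or.inl ?_)
    have h := two_mul_le_of_le_inv hn0.le hL (rpow_inv_ge_half hn1 hγ hgL) hc hg hs hd₂ hp hE hgL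
    rwa [← hγg] at h
  let r : Z ≃ ℕ := (Equiv.ofBijective e he).symm
  have hdecay' : ∀ j : ℕ, (Q (r.symm j)).toReal ≤ C * ((j : ℝ) + 1) ^ (-γ) := hdecay
  have hE₁ := measure_pi_exists_genGap_gt_le hBddAbove hBddBelow hDpos Q hn
    (fun m : {m : Multiset Z // m.card = n} => A m.1.toList)
    (fun m => rankWeight_pos r hn m.1) (tsum_rankWeight_le_one r hn) hδ₁ (by linarith)
  have hE₂ := measure_pi_sum_log_rank_ge_le Q r hC hγ hdecay' hn hδ₂
  have hE₃ := measure_pi_card_image_ge_le Q r hC hγ hdecay' hn hδ₃ (by linarith)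
  rw [← hμ] at hE₁ hE₂ hE₃
  set G := {ω : Fin n → Z | genGap ℓ Q ω (A (List.ofFn ω)) ≤
    lossDI ℓ * √((T + log (1 / δ₁)) / (2 * n))} with hG
  have hcompl : μ Gᶜ ≤ ENNReal.ofReal (δ₁ + δ₂ + δ₃) := by
    rw [ENNReal.ofReal_add (by positivity) hδ₃.le, ENNReal.ofReal_add hδ₁.le hδ₂.le]
    refine le_trans ?_ (add_le_add (add_le_add hE₁ hE₂) hE₃)
    refine le_trans (measure_mono fun ω hω => ?_)
      ((measure_union_le _ _).trans (add_le_add_left (measure_union_le _ _) _))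
    by_contra hgood
    simp only [Set.mem_union, not_or, Set.mem_ofPred_eq, not_exists, not_lt, not_le] at hgood
    obtain ⟨⟨hgap, hlogsum⟩, hcard⟩ := hgood
    refine hω ?_
    have hperm : A (List.ofFn ω : Multiset Z).toList = A (List.ofFn ω) :=
      hA _ _ (Multiset.coe_eq_coe.1 (Multiset.coe_toList _))
    have hgapω := hgap ⟨(List.ofFn ω : Multiset Z), by simp⟩
    rw [hperm] at hgapω
    refine hgapω.trans (mul_le_mul_of_nonneg_left (Real.sqrt_le_sqrt ?_) hD)
    have hCX : C * X ≤ max C 1 * X := mul_le_mul_of_nonneg_right (le_max_left _ _) (by linarith)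
    have hcode := code_length_le_of_inv_le hL hX hc hg hs hd₂ hp hE hgL
      (hcard.le.trans (by gcongr)) (hlogsum.le.trans (by gcongr))
    rw [← hγg] at hcode
    have hcost := (log_one_div_rankWeight_ofFn_le r hn ω).trans hcode
    gcongr
  have htotal : 1 ≤ μ G + μ Gᶜ := by
    rw [← measure_univ (μ := μ), ← Set.union_compl_self G]
    exact measure_union_le _ _
  rw [ENNReal.ofReal_sub _ (by positivity), ENNReal.ofReal_one, tsub_le_iff_right]
  exact htotal.trans (add_le_add_right hcompl _)
end

section
/- (Rényi-entropy-based bound on the effective type count for exponentially decaying distributions.) Let q = (q₀,q₁,…) be a probability mass function on ℕ and suppose there are constants C > 0 and r ∈ (0,1) with q_j ≤ C·r^j for all j ∈ ℕ. Set C̃ = max{C,1}. Then (i) for every α ∈ (0,1], ∑_{j=0}^∞ q_j^α ≤ C^α/(1 − r^α); and (ii) for every integer n ≥ 1, min_{α∈[0,1]} ( n^α · ∑_{j=0}^∞ q_j^α ) ≤ (e·C̃ / ln(1/r)) · ( ln n + ln(e/r) ). -/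
open Real ENNReal

theorem rpow_le_geometric_of_le {x C r α : ℝ} {j : ℕ} (hx : 0 ≤ x) (hC : 0 ≤ C) (hr : 0 ≤ r)
    (hα : 0 ≤ α) (h : x ≤ C * r ^ j) : x ^ α ≤ C ^ α * (r ^ α) ^ j := by
  calc x ^ α ≤ (C * r ^ j) ^ α := Real.rpow_le_rpow hx h hα
    _ = C ^ α * (r ^ α) ^ j := by
      rw [Real.mul_rpow hC (pow_nonneg hr j), ← Real.rpow_natCast, ← Real.rpow_natCast,
        ← Real.rpow_mul hr, ← Real.rpow_mul hr, mul_comm α]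

theorem summable_rpow_and_tsum_le_of_le_geometric {q : ℕ → ℝ} (hq : ∀ j, 0 ≤ q j) {C r α : ℝ}
    (hC : 0 ≤ C) (hr0 : 0 ≤ r) (hr1 : r < 1) (hα : 0 < α) (h : ∀ j, q j ≤ C * r ^ j) :
    Summable (fun j => q j ^ α) ∧ ∑' j, q j ^ α ≤ C ^ α / (1 - r ^ α) := by
  have hle : ∀ j, q j ^ α ≤ C ^ α * (r ^ α) ^ j := fun j =>
    rpow_le_geometric_of_le (hq j) hC hr0 hα.le (h j)
  have hgeom : HasSum (fun j : ℕ => C ^ α * (r ^ α) ^ j) (C ^ α / (1 - r ^ α)) := by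
    rw [div_eq_mul_inv]
    exact (hasSum_geometric_of_lt_one (Real.rpow_nonneg hr0 α)
      (Real.rpow_lt_one hr0 hr1 hα)).mul_left _
  have hsum : Summable (fun j => q j ^ α) :=
    hgeom.summable.of_nonneg_of_le (fun j => Real.rpow_nonneg (hq j) α) hle
  exact ⟨hsum, hsum.tsum_le_of_sum_le fun s =>
    (Finset.sum_le_sum fun j _ => hle j).trans <|
      sum_le_hasSum s (fun j _ => mul_nonneg (Real.rpow_nonneg hC α)
        (pow_nonneg (Real.rpow_nonneg hr0 α) j)) hgeom⟩

theorem one_div_one_sub_exp_neg_le {x : ℝ} (hx : 0 < x) :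
    1 / (1 - Real.exp (-x)) ≤ (1 + x) / x := by
  have hlt : Real.exp (-x) < 1 := Real.exp_lt_one_iff.2 (neg_neg_of_pos hx)
  have hmul : Real.exp x * Real.exp (-x) = 1 := by rw [← Real.exp_add]; simp
  rw [div_le_div_iff₀ (by linarith) hx]
  nlinarith [Real.add_one_le_exp x, Real.exp_pos (-x)]

theorem rpow_le_max_one {C α : ℝ} (hC : 0 ≤ C) (hα0 : 0 ≤ α) (hα1 : α ≤ 1) :
    C ^ α ≤ max C 1 := by
  calc C ^ α ≤ (max C 1) ^ α := Real.rpow_le_rpow hC (le_max_left _ _) hα0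
    _ ≤ (max C 1) ^ (1 : ℝ) := Real.rpow_le_rpow_of_exponent_le (le_max_right _ _) hα1
    _ = max C 1 := Real.rpow_one _

/-- **Rényi-entropy-based bound on the effective type count for exponentially
decaying distributions.** Let `q` be a probability mass function on `ℕ` with
`q_j ≤ C·r^j` (`C > 0`, `r ∈ (0,1)`), and set `C̃ = max{C,1}`. Then
(i) for every `α ∈ (0,1]`, `∑_j q_j^α ≤ C^α/(1 − r^α)` (note `∑_j q_j^α = exp((1−α)H_α(q))`);
(ii) for every `n ≥ 1`,
`min_{α∈[0,1]} n^α·∑_j q_j^α ≤ (e·C̃/ln(1/r))·(ln n + ln(e/r))`, where the minimand is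
stated in `ℝ≥0∞` (with the convention `0⁰ = 0`) so that divergent sums are `∞`. -/
theorem renyi_effective_type_count_exponential
    (q : ℕ → ℝ) (hq0 : ∀ j, 0 ≤ q j) (hqs : Summable q) (hq1 : ∑' j, q j = 1)
    (C r : ℝ) (hC : 0 < C) (hr : r ∈ Set.Ioo (0 : ℝ) 1)
    (hdecay : ∀ j : ℕ, q j ≤ C * r ^ j) :
    (∀ α ∈ Set.Ioc (0 : ℝ) 1, (∑' j, q j ^ α) ≤ C ^ α / (1 - r ^ α)) ∧
    (∀ n : ℕ, 1 ≤ n →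
      (⨅ α ∈ Set.Icc (0 : ℝ) 1,
          (n : ℝ≥0∞) ^ α * ∑' j, (if q j = 0 then 0 else ENNReal.ofReal (q j) ^ α)) ≤
        ENNReal.ofReal
          ((Real.exp 1 * max C 1 / Real.log (1 / r)) *
            (Real.log n + Real.log (Real.exp 1 / r)))) := by
  obtain ⟨hr0, hr1⟩ := hr
  refine ⟨fun α hα => (summable_rpow_and_tsum_le_of_le_geometric hq0 hC.le hr0.le hr1 hα.1
    hdecay).2, fun n hn => ?_⟩
  have hn' : (1 : ℝ) ≤ n := by exact_mod_cast hn
  have hn0 : (0 : ℝ) < n := by linarith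
  have hlogn : 0 ≤ Real.log n := Real.log_nonneg hn'
  set α : ℝ := 1 / (Real.log n + 1) with hαdef
  have hα0 : 0 < α := by positivity
  have hα1 : α ≤ 1 := by
    rw [hαdef, div_le_one (by linarith)]
    linarith
  obtain ⟨hsum, htsum⟩ :=
    summable_rpow_and_tsum_le_of_le_geometric hq0 hC.le hr0.le hr1 hα0 hdecay
  set l : ℝ := Real.log (1 / r) with hl
  have hlr : Real.log r = -l := by rw [hl, one_div, Real.log_inv, neg_neg]
  have hl0 : 0 < l := Real.log_pos (one_lt_one_div hr0 hr1)
  have her : Real.log (Real.exp 1 / r) = 1 + l := by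
    rw [Real.log_div (Real.exp_pos 1).ne' hr0.ne', Real.log_exp, hlr]
    ring
  have hnα : (n : ℝ) ^ α ≤ Real.exp 1 := by
    rw [Real.rpow_def_of_pos hn0, Real.exp_le_exp, hαdef, mul_one_div,
      div_le_one (by linarith)]
    linarith
  have hrα : r ^ α = Real.exp (-(α * l)) := by
    rw [Real.rpow_def_of_pos hr0, hlr]
    ring_nf
  have hgeom : 1 / (1 - r ^ α) ≤ (Real.log n + (1 + l)) / l := by
    rw [hrα]
    refine (one_div_one_sub_exp_neg_le (mul_pos hα0 hl0)).trans_eq ?_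
    rw [hαdef]
    field_simp
    ring
  have hden : 0 < 1 - r ^ α := sub_pos.2 (Real.rpow_lt_one hr0.le hr1 hα0)
  have hS : ∑' j, q j ^ α ≤ max C 1 * ((Real.log n + (1 + l)) / l) := by
    refine htsum.trans ?_
    rw [div_eq_mul_one_div]
    exact mul_le_mul (rpow_le_max_one hC.le hα0.le hα1) hgeom (by positivity) (by positivity)
  have hbound : (n : ℝ) ^ α * ∑' j, q j ^ α ≤
      Real.exp 1 * max C 1 / l * (Real.log n + Real.log (Real.exp 1 / r)) := by
    calc (n : ℝ) ^ α * ∑' j, q j ^ α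
        ≤ Real.exp 1 * (max C 1 * ((Real.log n + (1 + l)) / l)) :=
          mul_le_mul hnα hS (tsum_nonneg fun j => Real.rpow_nonneg (hq0 j) α)
            (Real.exp_pos 1).le
      _ = _ := by
        rw [her]
        ring
  refine (iInf₂_le α ⟨hα0.le, hα1⟩).trans (le_trans ?_ (ENNReal.ofReal_le_ofReal hbound))
  rw [ENNReal.ofReal_mul (Real.rpow_nonneg hn0.le α),
    ENNReal.ofReal_tsum_of_nonneg (fun j => Real.rpow_nonneg (hq0 j) α) hsum,
    ← ENNReal.ofReal_rpow_of_pos hn0, ENNReal.ofReal_natCast]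
  gcongr with j
  split_ifs
  · exact zero_le
  · exact (ENNReal.ofReal_rpow_of_nonneg (hq0 j) hα0.le).le
end

section
/- (Rényi moment bound for power-law decaying distributions.) Let q = (q₀,q₁,…) be a probability mass function on ℕ and suppose there are constants C > 0 and γ > 1 with q_j ≤ C·(j+1)^{−γ} for all j ∈ ℕ. Then for every α ∈ (1/γ, 1], ∑_{j=0}^∞ q_j^α ≤ C^α · (α·γ)/(α·γ − 1). Moreover, setting C̃ = max{C,1}, for every integer n ≥ 1, min_{α∈(1/γ,1]} ( n^α · ∑_{j=0}^∞ q_j^α ) ≤ (e·C̃/(γ−1)) · n^{1/γ} · (ln n + γ). -/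
open Real

/-- A term of the `s`-series is bounded by the telescoping difference of its antiderivative. -/
lemma mul_add_one_rpow_neg_le_sub {s x : ℝ} (hs : 1 < s) (hx : 0 < x) :
    (s - 1) * (x + 1) ^ (-s) ≤ x ^ (1 - s) - (x + 1) ^ (1 - s) := by
  have hx1 : 0 < x + 1 := by linarith
  have hlog : 1 / (x + 1) ≤ log (x + 1) - log x := by
    have h := log_le_sub_one_of_pos (div_pos hx hx1)
    rw [log_div hx.ne' hx1.ne'] at h
    have h2 : x / (x + 1) - 1 = -(1 / (x + 1)) := by field_simp; ring
    linarith
  have hratio : x ^ (1 - s) = (x + 1) ^ (1 - s) * exp ((s - 1) * (log (x + 1) - log x)) := by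
    rw [rpow_def_of_pos hx, rpow_def_of_pos hx1, ← exp_add]
    ring_nf
  have hsplit : (x + 1) ^ (-s) = (x + 1) ^ (1 - s) * (1 / (x + 1)) := by
    rw [show -s = (1 - s) - 1 by ring, rpow_sub_one hx1.ne']
    ring
  have hexp : 1 + (s - 1) * (1 / (x + 1)) ≤ exp ((s - 1) * (log (x + 1) - log x)) := by
    have h := add_one_le_exp ((s - 1) * (log (x + 1) - log x))
    have h2 := mul_le_mul_of_nonneg_left hlog (by linarith : 0 ≤ s - 1)
    linarith
  have h := mul_le_mul_of_nonneg_left hexp (rpow_pos_of_pos hx1 (1 - s)).le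
  rw [hratio, hsplit]
  linarith

/-- Partial sums of the `s`-series are at most `s / (s - 1)`. -/
lemma sum_range_add_one_rpow_neg_le {s : ℝ} (hs : 1 < s) (N : ℕ) :
    ∑ j ∈ Finset.range N, ((j : ℝ) + 1) ^ (-s) ≤ s / (s - 1) := by
  have hs' : 0 < s - 1 := by linarith
  have key : ∀ N : ℕ, (s - 1) * ∑ j ∈ Finset.range (N + 1), ((j : ℝ) + 1) ^ (-s) ≤
      s - ((N : ℝ) + 1) ^ (1 - s) := by
    intro N
    induction N with
    | zero => simp
    | succ k ih =>
      rw [Finset.sum_range_succ, mul_add]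
      have h := mul_add_one_rpow_neg_le_sub hs (by positivity : (0 : ℝ) < (k : ℝ) + 1)
      push_cast
      linarith
  rw [le_div_iff₀ hs', mul_comm]
  have hmono : ∑ j ∈ Finset.range N, ((j : ℝ) + 1) ^ (-s) ≤
      ∑ j ∈ Finset.range (N + 1), ((j : ℝ) + 1) ^ (-s) := by
    rw [Finset.sum_range_succ]
    have : (0 : ℝ) ≤ ((N : ℝ) + 1) ^ (-s) := by positivity
    linarith
  have h := mul_le_mul_of_nonneg_left hmono hs'.le
  have h2 : (0 : ℝ) ≤ ((N : ℝ) + 1) ^ (1 - s) := by positivity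
  linarith [key N]

/-- The `α`-moment of a nonnegative sequence with power-law decay. -/
lemma tsum_rpow_le_of_le_rpow_neg {q : ℕ → ℝ} (hq0 : ∀ j, 0 ≤ q j) {C γ α : ℝ} (hC : 0 ≤ C)
    (hα : 0 ≤ α) (hαγ : 1 < α * γ) (hdecay : ∀ j : ℕ, q j ≤ C * ((j : ℝ) + 1) ^ (-γ)) :
    ∑' j, q j ^ α ≤ C ^ α * (α * γ) / (α * γ - 1) := by
  refine Real.tsum_le_of_sum_range_le (fun j => rpow_nonneg (hq0 j) α) fun N => ?_
  calc ∑ j ∈ Finset.range N, q j ^ α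
      ≤ ∑ j ∈ Finset.range N, C ^ α * ((j : ℝ) + 1) ^ (-(α * γ)) := by
        refine Finset.sum_le_sum fun j _ => ?_
        have hj : (0 : ℝ) ≤ (j : ℝ) + 1 := by positivity
        calc q j ^ α ≤ (C * ((j : ℝ) + 1) ^ (-γ)) ^ α := rpow_le_rpow (hq0 j) (hdecay j) hα
          _ = C ^ α * ((j : ℝ) + 1) ^ (-(α * γ)) := by
            rw [mul_rpow hC (rpow_nonneg hj _), ← rpow_mul hj]
            ring_nf
    _ ≤ C ^ α * (α * γ / (α * γ - 1)) := by
        rw [← Finset.mul_sum]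
        exact mul_le_mul_of_nonneg_left (sum_range_add_one_rpow_neg_le hαγ N) (rpow_nonneg hC α)
    _ = C ^ α * (α * γ) / (α * γ - 1) := by ring

/-- A near-optimal order: the exponent `α = γ⁻¹ + δ` with `δ = min (1 / L) (1 - γ⁻¹)`. -/
lemma exists_order_mem_Ioc {γ L : ℝ} (hγ : 1 < γ) (hL : 0 ≤ L) :
    ∃ α ∈ Set.Ioc γ⁻¹ 1, (α - γ⁻¹) * L ≤ 1 ∧
      α * γ / (α * γ - 1) ≤ (L + γ) / (γ - 1) := by
  have hγ0 : 0 < γ := by linarith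
  have hγ1 : 0 < γ - 1 := by linarith
  have hinv : γ⁻¹ < 1 := inv_lt_one_of_one_lt₀ hγ
  by_cases h : (1 - γ⁻¹) * L ≤ 1
  · refine ⟨1, ⟨hinv, le_rfl⟩, h, ?_⟩
    rw [one_mul]
    gcongr
    linarith
  · push Not at h
    have hL0 : 0 < L := by
      by_contra! h0
      nlinarith
    refine ⟨γ⁻¹ + 1 / L, ⟨by simpa using hL0, ?_⟩, ?_, ?_⟩
    · have : 1 / L ≤ 1 - γ⁻¹ := by rw [div_le_iff₀ hL0]; exact h.le
      linarith
    · apply le_of_eq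
      field_simp
      ring
    · have : (γ⁻¹ + 1 / L) * γ / ((γ⁻¹ + 1 / L) * γ - 1) = (L + γ) / γ := by
        have h1 : (γ⁻¹ + 1 / L) * γ = 1 + γ / L := by field_simp
        rw [h1, add_sub_cancel_left]
        field_simp
      rw [this]
      gcongr
      linarith

/-- **Rényi moment bound for power-law decaying distributions.** Let `q` be a
probability mass function on `ℕ` with `q_j ≤ C·(j+1)^{−γ}` (`C > 0`, `γ > 1`), and
set `C̃ = max{C,1}`. Then (i) for every `α ∈ (1/γ,1]`,
`∑_j q_j^α ≤ C^α·(αγ)/(αγ−1)` (note `∑_j q_j^α = exp((1−α)H_α(q))`); and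
(ii) for every `n ≥ 1`, `min_{α∈(1/γ,1]} n^α·∑_j q_j^α ≤ (e·C̃/(γ−1))·n^{1/γ}·(ln n + γ)`. -/
theorem renyi_moment_bound_power_law
    (q : ℕ → ℝ) (hq0 : ∀ j, 0 ≤ q j) (hqs : Summable q) (hq1 : ∑' j, q j = 1)
    (C γ : ℝ) (hC : 0 < C) (hγ : 1 < γ)
    (hdecay : ∀ j : ℕ, q j ≤ C * ((j : ℝ) + 1) ^ (-γ)) :
    (∀ α ∈ Set.Ioc γ⁻¹ 1, (∑' j, q j ^ α) ≤ C ^ α * (α * γ) / (α * γ - 1)) ∧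
    (∀ n : ℕ, 1 ≤ n →
      sInf ((fun α : ℝ => (n : ℝ) ^ α * ∑' j, q j ^ α) '' Set.Ioc γ⁻¹ 1) ≤
        (Real.exp 1 * max C 1 / (γ - 1)) * (n : ℝ) ^ γ⁻¹ * (Real.log n + γ)) := by
  have hγ0 : 0 < γ := by linarith
  have hone : ∀ α ∈ Set.Ioc γ⁻¹ 1, 1 < α * γ := fun α hα => (inv_lt_iff_one_lt_mul₀ hγ0).mp hα.1
  have hpos : ∀ α ∈ Set.Ioc γ⁻¹ 1, 0 < α := fun α hα => (inv_pos.mpr hγ0).trans hα.1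
  have hmoment : ∀ α ∈ Set.Ioc γ⁻¹ 1, (∑' j, q j ^ α) ≤ C ^ α * (α * γ) / (α * γ - 1) :=
    fun α hα => tsum_rpow_le_of_le_rpow_neg hq0 hC.le (hpos α hα).le (hone α hα) hdecay
  refine ⟨hmoment, fun n hn => ?_⟩
  have hn0 : (0 : ℝ) < n := by exact_mod_cast hn
  have hL : 0 ≤ log n := log_natCast_nonneg n
  obtain ⟨α, hα, hδ, hfrac⟩ := exists_order_mem_Ioc hγ hL
  have hbdd : BddBelow ((fun α : ℝ => (n : ℝ) ^ α * ∑' j, q j ^ α) '' Set.Ioc γ⁻¹ 1) := by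
    refine ⟨0, ?_⟩
    rintro _ ⟨β, -, rfl⟩
    exact mul_nonneg (rpow_nonneg hn0.le β) (tsum_nonneg fun j => rpow_nonneg (hq0 j) β)
  refine (csInf_le hbdd ⟨α, hα, rfl⟩).trans ?_
  have hCα : C ^ α ≤ max C 1 :=
    calc C ^ α ≤ max C 1 ^ α := rpow_le_rpow hC.le (le_max_left _ _) (hpos α hα).le
      _ ≤ max C 1 ^ (1 : ℝ) := rpow_le_rpow_of_exponent_le (le_max_right _ _) hα.2
      _ = max C 1 := rpow_one _
  have hnα : (n : ℝ) ^ α ≤ (n : ℝ) ^ γ⁻¹ * exp 1 :=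
    calc (n : ℝ) ^ α = (n : ℝ) ^ γ⁻¹ * exp ((α - γ⁻¹) * log n) := by
          rw [rpow_def_of_pos hn0, rpow_def_of_pos hn0, ← exp_add]
          ring_nf
      _ ≤ (n : ℝ) ^ γ⁻¹ * exp 1 := by gcongr
  have hfrac0 : 0 ≤ α * γ / (α * γ - 1) := by
    have := hone α hα
    exact div_nonneg (by linarith) (by linarith)
  have hmax : 0 ≤ max C 1 := hC.le.trans (le_max_left _ _)
  calc (n : ℝ) ^ α * ∑' j, q j ^ α
      ≤ (n : ℝ) ^ α * (C ^ α * (α * γ / (α * γ - 1))) := by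
        rw [← mul_div_assoc]
        exact mul_le_mul_of_nonneg_left (hmoment α hα) (rpow_nonneg hn0.le α)
    _ ≤ ((n : ℝ) ^ γ⁻¹ * exp 1) * (max C 1 * ((log n + γ) / (γ - 1))) := by
        have := rpow_nonneg hC.le α
        gcongr
    _ = (exp 1 * max C 1 / (γ - 1)) * (n : ℝ) ^ γ⁻¹ * (log n + γ) := by ring
end
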